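/- Let (A_S,S) be an Artin-Tits system of spherical type, X,Y ⊆ S and g ∈ A_S with gX = Yg. Let g = g₁g₂⁻¹ be the right normal form of g (g₁,g₂ ∈ A_S⁺ with trivial right gcd). Then there exists a subset X' ⊆ S such that g₁ ∈ Conj⁺(S;X',Y) and g₂ ∈ Conj⁺(S;X',X), i.e. g₁X' = Yg₁ and g₂X' = Xg₂. -/

import Mathlib

/-!
Common definitions for formalizing "Normalisateur des sous-groupes paraboliques
des groupes d'Artin-Tits" (E. Godelle).

We fix a Coxeter matrix `M` over a finite index set `B` (Mathlib's convention:
`M s t = 0` encodes `m_{s,t} = ∞`).  The Artin-Tits group `Artin M` is the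
presented group on the braid relations, the Coxeter group is Mathlib's
`M.Group`, and `proj : Artin M →* M.Group` is the canonical projection
(adding the relations `s² = 1`).
-/

namespace ArtinTitsPaper

open List

variable {B : Type*}

/-- The alternating list `[s, t, s, t, ...]` with `n` terms, starting with `s`. -/
def altList (s t : B) : ℕ → List B
  | 0 => []
  | n + 1 => s :: altList t s n

/-- The braid relators `(sts⋯)(tst⋯)⁻¹` (`m_{s,t}` letters each) for `s ≠ t`,
`m_{s,t} ≠ ∞`. -/
def braidRels (M : CoxeterMatrix B) : Set (FreeGroup B) :=
  { r | ∃ s t : B, s ≠ t ∧ M s t ≠ 0 ∧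
      r = ((altList s t (M s t)).map FreeGroup.of).prod *
          (((altList t s (M s t)).map FreeGroup.of).prod)⁻¹ }

/-- The Artin-Tits group associated to the Coxeter matrix `M`. -/
def Artin (M : CoxeterMatrix B) : Type _ := PresentedGroup (braidRels M)

instance (M : CoxeterMatrix B) : Group (Artin M) :=
  QuotientGroup.Quotient.group _

/-- The standard generator of `Artin M` indexed by `s : B` (the image of `S` in `A_S`). -/
def gen (M : CoxeterMatrix B) (s : B) : Artin M := PresentedGroup.of s

theorem altList_eq_reverse_alternatingWord (s t : B) (n : ℕ) :
    altList s t n = (CoxeterSystem.alternatingWord t s n).reverse := by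
  induction n generalizing s t with
  | zero => rfl
  | succ n ih =>
      rw [altList, CoxeterSystem.alternatingWord_succ, List.concat_eq_append,
        List.reverse_append]
      simp [ih]

theorem lift_simple_listProd (M : CoxeterMatrix B) (l : List B) :
    FreeGroup.lift M.simple ((l.map FreeGroup.of).prod) =
      M.toCoxeterSystem.wordProd l := by
  rw [CoxeterSystem.wordProd, map_list_prod, List.map_map]
  simp [Function.comp_def, CoxeterMatrix.toCoxeterSystem_simple]

theorem braid_lift (M : CoxeterMatrix B) :
    ∀ r ∈ braidRels M, FreeGroup.lift M.simple r = 1 := by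
  rintro r ⟨s, t, hst, hm, rfl⟩
  rw [map_mul, map_inv, lift_simple_listProd, lift_simple_listProd,
    altList_eq_reverse_alternatingWord, altList_eq_reverse_alternatingWord,
    CoxeterSystem.wordProd_reverse, CoxeterSystem.wordProd_reverse]
  have hsym : M s t = M t s := M.symmetric s t
  have hb := M.toCoxeterSystem.wordProd_braidWord_eq t s
  rw [CoxeterSystem.braidWord, CoxeterSystem.braidWord, ← hsym] at hb
  rw [hb]
  simp

/-- The canonical projection from the Artin-Tits group onto the Coxeter group
(adding the relations `s² = 1`). -/
def proj (M : CoxeterMatrix B) : Artin M →* M.Group :=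
  PresentedGroup.toGroup (braid_lift M)

/-- The positive monoid `A_S⁺`, the submonoid of `A_S` generated by `S`. -/
def posMon (M : CoxeterMatrix B) : Submonoid (Artin M) :=
  Submonoid.closure (Set.range (gen M))

/-- The submonoid `A_X⁺` of `A_S` generated by `X ⊆ S`. -/
def posMonOn (M : CoxeterMatrix B) (X : Set B) : Submonoid (Artin M) :=
  Submonoid.closure (gen M '' X)

/-- The standard parabolic subgroup `A_X` of `A_S` generated by `X ⊆ S`. -/
def stdSub (M : CoxeterMatrix B) (X : Set B) : Subgroup (Artin M) :=
  Subgroup.closure (gen M '' X)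

/-- The standard parabolic subgroup `W_X` of the Coxeter group `W_S`. -/
def coxSub (M : CoxeterMatrix B) (X : Set B) : Subgroup M.Group :=
  Subgroup.closure (M.simple '' X)

/-- `X ⊆ S` is of spherical type if the Coxeter group `W_X` is finite. -/
def IsSpherical (M : CoxeterMatrix B) (X : Set B) : Prop :=
  Finite (coxSub M X)

/-- `a` left-divides `b` in the positive monoid: `b = a c` with `c ∈ A_S⁺`. -/
def ldvd (M : CoxeterMatrix B) (a b : Artin M) : Prop :=
  ∃ c ∈ posMon M, a * c = b

/-- `a` right-divides `b` in the positive monoid: `b = c a` with `c ∈ A_S⁺`. -/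
def rdvd (M : CoxeterMatrix B) (a b : Artin M) : Prop :=
  ∃ c ∈ posMon M, c * a = b

/-- `d` is the least common multiple `Δ_X` of `X` in `A_X⁺` (for left-divisibility). -/
def IsDelta (M : CoxeterMatrix B) (X : Set B) (d : Artin M) : Prop :=
  d ∈ posMonOn M X ∧
  (∀ s ∈ X, ∃ c ∈ posMonOn M X, gen M s * c = d) ∧
  ∀ m ∈ posMonOn M X, (∀ s ∈ X, ∃ c ∈ posMonOn M X, gen M s * c = m) →
    ∃ c ∈ posMonOn M X, d * c = m

/-- The subset `Xg = {σ_x g : x ∈ X}` of `A_S`. -/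
def leftMul (M : CoxeterMatrix B) (X : Set B) (g : Artin M) : Set (Artin M) :=
  (fun x => gen M x * g) '' X

/-- The subset `gX = {g σ_x : x ∈ X}` of `A_S`. -/
def rightMul (M : CoxeterMatrix B) (X : Set B) (g : Artin M) : Set (Artin M) :=
  (fun x => g * gen M x) '' X

/-- `Conj(S;X,Y) = {g ∈ A_S : gX = Yg}`. -/
def conjSet (M : CoxeterMatrix B) (X Y : Set B) : Set (Artin M) :=
  { g | rightMul M X g = leftMul M Y g }

/-- `Conj⁺(S;X,Y) = {g ∈ A_S⁺ : gX = Yg}`. -/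
def conjPos (M : CoxeterMatrix B) (X Y : Set B) : Set (Artin M) :=
  { g | g ∈ posMon M ∧ rightMul M X g = leftMul M Y g }

/-- The quasi-centralizer `QZ_{A_S}(A_X) = {g ∈ A_S : gX = Xg}`. -/
def QZset (M : CoxeterMatrix B) (X : Set B) : Set (Artin M) :=
  conjSet M X X

/-- The indecomposable component of `Z` containing `t` (vertices of `Z` joined to `t`
by a path of edges `m_{a,b} ≠ 2` in the Coxeter diagram on `Z`). -/
def comp (M : CoxeterMatrix B) (Z : Set B) (t : B) : Set B :=
  { s ∈ Z | Relation.ReflTransGen (fun a b => a ∈ Z ∧ b ∈ Z ∧ a ≠ b ∧ M a b ≠ 2) t s }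

/-- `Z` is indecomposable: it admits no nontrivial partition `Z = Z₁ ∪ Z₂` with
`m_{a,b} = 2` for `a ∈ Z₁`, `b ∈ Z₂`. -/
def Indecomp (M : CoxeterMatrix B) (Z : Set B) : Prop :=
  ¬ ∃ Z₁ Z₂ : Set B, Z₁.Nonempty ∧ Z₂.Nonempty ∧ Z₁ ∪ Z₂ = Z ∧ Disjoint Z₁ Z₂ ∧
      ∀ a ∈ Z₁, ∀ b ∈ Z₂, M a b = 2

/-- `g` is an elementary positive `Y`-ribbon-`X`: `g = d_{X,t}` for some `t ∈ S` with
`X(t)` of spherical type, where `d_{X,t} = Δ_{X(t)}` if `t ∈ X` and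
`d_{X,t} = Δ_{X(t)} Δ_{X(t)∖{t}}⁻¹` otherwise, and `Y ⊆ X ∪ {t}` satisfies `Yg = gX`. -/
def IsElemRibbon (M : CoxeterMatrix B) (X Y : Set B) (g : Artin M) : Prop :=
  ∃ t : B, IsSpherical M (comp M (X ∪ {t}) t) ∧
    ((t ∈ X ∧ IsDelta M (comp M (X ∪ {t}) t) g) ∨
      (t ∉ X ∧ ∃ d₁ d₂ : Artin M, IsDelta M (comp M (X ∪ {t}) t) d₁ ∧
        IsDelta M ((comp M (X ∪ {t}) t) \ {t}) d₂ ∧ g = d₁ * d₂⁻¹)) ∧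
    Y ⊆ X ∪ {t} ∧ leftMul M Y g = rightMul M X g

/-- `g` is a positive `Y`-ribbon-`X`: a product `g = g_n ⋯ g_1` of elementary positive
`X_i`-ribbons-`X_{i-1}` with `X_0 = X`, `X_n = Y`. -/
inductive IsRibbon (M : CoxeterMatrix B) : Set B → Set B → Artin M → Prop
  | nil (X : Set B) : IsRibbon M X X 1
  | cons {X Y Z : Set B} {g h : Artin M} :
      IsRibbon M X Y g → IsElemRibbon M Y Z h → IsRibbon M X Z (h * g)

/-- `g` is `X`-reduced: no element of `X` left-divides `g`. -/
def lreduced (M : CoxeterMatrix B) (X : Set B) (g : Artin M) : Prop :=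
  ∀ s ∈ X, ¬ ldvd M (gen M s) g

/-- `g` is reduced-`X`: no element of `X` right-divides `g`. -/
def rreduced (M : CoxeterMatrix B) (X : Set B) (g : Artin M) : Prop :=
  ∀ s ∈ X, ¬ rdvd M (gen M s) g

/-- The set `H_X` of elements `g₁ g₂⁻¹` where `g₁, g₂` are `X`-reduced positive
`X`-ribbons-`X`. -/
def HXset (M : CoxeterMatrix B) (X : Set B) : Set (Artin M) :=
  { g | ∃ g₁ g₂ : Artin M, IsRibbon M X X g₁ ∧ lreduced M X g₁ ∧
      IsRibbon M X X g₂ ∧ lreduced M X g₂ ∧ g = g₁ * g₂⁻¹ }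

/-- The length of a positive element (the common length of its expressions as words
in the generators; junk value `0` outside of `A_S⁺`). -/
noncomputable def len (M : CoxeterMatrix B) (g : Artin M) : ℕ :=
  sInf { n | ∃ l : List B, l.length = n ∧ (l.map (gen M)).prod = g }

/-- The length of an element of the Coxeter group `W_S`. -/
noncomputable def wlen (M : CoxeterMatrix B) (w : M.Group) : ℕ :=
  sInf { n | ∃ l : List B, l.length = n ∧ (l.map M.simple).prod = w }

/-- `g ∈ A_{S,red}`: `g` is positive and has the same length as its image in `W_S`. -/
def Red (M : CoxeterMatrix B) (g : Artin M) : Prop :=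
  g ∈ posMon M ∧ len M g = wlen M (proj M g)

/-- `C` is a simple `s`-chain-`u`: either `C = 1` and `s = u`, or
`C = tst⋯` (`k` letters, `k < m_{s,t}`) with `u ∈ {s,t}` and `C·u = tst⋯` (`k+1` letters). -/
def IsSimpleChain (M : CoxeterMatrix B) (s u : B) (C : Artin M) : Prop :=
  (C = 1 ∧ s = u) ∨
  ∃ t : B, t ≠ s ∧ (u = s ∨ u = t) ∧ ∃ k : ℕ,
    (M s t = 0 ∨ k < M s t) ∧
    C = ((altList t s k).map (gen M)).prod ∧
    C * gen M u = ((altList t s (k + 1)).map (gen M)).prod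

/-- `C` is an `s`-chain-`t`: a product `C₁ ⋯ C_k` of simple chains composing from
origin `s` to target `t`. -/
inductive IsChain (M : CoxeterMatrix B) : B → B → Artin M → Prop
  | single {s u : B} {C : Artin M} : IsSimpleChain M s u C → IsChain M s u C
  | comp {s u v : B} {C D : Artin M} :
      IsChain M s u C → IsSimpleChain M u v D → IsChain M s v (C * D)

section Coxeter

theorem end_mul_apply {α : Type*} (f g : Function.End α) (x : α) : (f * g) x = f (g x) := rfl

variable {W : Type*} [Group W] {M : CoxeterMatrix B} (cs : CoxeterSystem M W)

open Classical in
/-- The action of a simple reflection on `W × ZMod 2` recording parities of inversions. -/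
noncomputable def flip (i : B) : Function.End (W × ZMod 2) := fun p =>
  (cs.simple i * p.1 * cs.simple i, p.2 + if p.1 = cs.simple i then 1 else 0)

open Classical in
theorem flip_mul_flip_pow (i j : B) (n : ℕ) (x : W) (e : ZMod 2) :
    ((flip cs i * flip cs j) ^ n) (x, e) =
      ((cs.simple i * cs.simple j) ^ n * x * ((cs.simple i * cs.simple j) ^ n)⁻¹,
        e + ∑ k ∈ Finset.range (2 * n),
          if x = cs.simple j * (cs.simple i * cs.simple j) ^ k then 1 else 0) := by
  induction n with
  | zero => simp; rfl
  | succ n ih =>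
    rw [pow_succ', end_mul_apply, ih, end_mul_apply]
    have hpow : ∀ k : ℕ, cs.simple j * (cs.simple i * cs.simple j) ^ k =
        ((cs.simple i * cs.simple j) ^ k)⁻¹ * cs.simple j := by
      intro k
      induction k with
      | zero => simp
      | succ k ihk =>
        rw [pow_succ, ← mul_assoc, ihk, ← pow_succ, pow_succ']
        simp [mul_assoc]
    have h1 : (cs.simple i * cs.simple j) ^ n * x * ((cs.simple i * cs.simple j) ^ n)⁻¹ =
        cs.simple j ↔ x = cs.simple j * (cs.simple i * cs.simple j) ^ (2 * n) := by
      rw [two_mul, pow_add, ← mul_assoc, hpow, mul_inv_eq_iff_eq_mul, mul_assoc, eq_inv_mul_iff_mul_eq]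
    have h2 : cs.simple j * ((cs.simple i * cs.simple j) ^ n * x *
        ((cs.simple i * cs.simple j) ^ n)⁻¹) * cs.simple j = cs.simple i ↔
        x = cs.simple j * (cs.simple i * cs.simple j) ^ (2 * n + 1) := by
      have : cs.simple j * (cs.simple i * cs.simple j) ^ (2 * n + 1) =
          ((cs.simple i * cs.simple j) ^ n)⁻¹ * (cs.simple j * cs.simple i * cs.simple j) *
            (cs.simple i * cs.simple j) ^ n := by
        rw [show 2 * n + 1 = n + (1 + n) by ring, pow_add, ← mul_assoc, hpow, pow_add]
        simp [mul_assoc]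
      rw [this]
      constructor
      · intro h
        generalize (cs.simple i * cs.simple j) ^ n = p at h ⊢
        rw [← h]
        simp [mul_assoc]
      · rintro rfl
        simp [mul_assoc]
    simp only [flip, h1, h2, Prod.mk.injEq]
    constructor
    · simp [pow_succ', mul_assoc]
    · rw [show 2 * (n + 1) = 2 * n + 1 + 1 by ring, Finset.sum_range_succ, Finset.sum_range_succ]
      ring

theorem isLiftable_flip : M.IsLiftable (flip cs) := by
  classical
  intro i j
  funext ⟨x, e⟩
  rw [flip_mul_flip_pow, two_mul, Finset.sum_range_add]
  simp only [pow_add, cs.simple_mul_simple_pow, one_mul, inv_one, mul_one]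
  rw [CharTwo.add_self_eq_zero]
  simp; rfl

/-- The action of `W` on `W × ZMod 2` recording parities of inversions. -/
noncomputable def flipHom : W →* Function.End (W × ZMod 2) :=
  cs.lift ⟨flip cs, isLiftable_flip cs⟩

open Classical in
theorem flipHom_wordProd (ω : List B) (x : W) (e : ZMod 2) :
    flipHom cs (cs.wordProd ω) (x, e) =
      (cs.wordProd ω * x * (cs.wordProd ω)⁻¹, e + ((cs.rightInvSeq ω).count x : ℕ)) := by
  induction ω with
  | nil => simp; rfl
  | cons i ω ih =>
    rw [cs.wordProd_cons, map_mul, end_mul_apply, ih]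
    rw [flipHom, cs.lift_apply_simple, flip, CoxeterSystem.rightInvSeq, List.count_cons]
    simp only [Prod.mk.injEq]
    constructor
    · simp [mul_assoc]
    · have : (cs.wordProd ω * x * (cs.wordProd ω)⁻¹ = cs.simple i) ↔
        ((cs.wordProd ω)⁻¹ * cs.simple i * cs.wordProd ω = x) := by
        constructor
        · intro h; rw [← h]; simp [mul_assoc]
        · intro h; rw [← h]; simp [mul_assoc]
      simp only [this, beq_iff_eq]
      push_cast
      ring

theorem flipHom_fst (w x : W) (e : ZMod 2) : (flipHom cs w (x, e)).1 = w * x * w⁻¹ := by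
  obtain ⟨ω, rfl⟩ := cs.wordProd_surjective w
  rw [flipHom_wordProd]

theorem flipHom_snd (w x : W) (e : ZMod 2) :
    (flipHom cs w (x, e)).2 = e + (flipHom cs w (x, 0)).2 := by
  obtain ⟨ω, rfl⟩ := cs.wordProd_surjective w
  simp [flipHom_wordProd]

theorem flipHom_mul_snd (u w x : W) :
    (flipHom cs (u * w) (x, 0)).2 =
      (flipHom cs w (x, 0)).2 + (flipHom cs u (w * x * w⁻¹, 0)).2 := by
  rw [map_mul, end_mul_apply, ← flipHom_snd, ← flipHom_fst cs w x 0]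

theorem flipHom_reflection {t : W} (ht : cs.IsReflection t) : (flipHom cs t (t, 0)).2 = 1 := by
  classical
  obtain ⟨u, i, rfl⟩ := ht
  rw [flipHom_mul_snd, flipHom_mul_snd]
  have h1 : u⁻¹ * (u * cs.simple i * u⁻¹) * u⁻¹⁻¹ = cs.simple i := by simp [mul_assoc]
  have h2 := flipHom_mul_snd cs u u⁻¹ (u * cs.simple i * u⁻¹)
  rw [h1] at h2 ⊢
  have h3 : (flipHom cs (cs.simple i) (cs.simple i, 0)).2 = 1 := by
    rw [← cs.wordProd_singleton, flipHom_wordProd]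
    simp
  rw [h3]
  have h4 : (flipHom cs (u * u⁻¹) (u * cs.simple i * u⁻¹, 0)).2 = 0 := by
    rw [mul_inv_cancel, map_one]; rfl
  rw [h4] at h2
  have h5 : cs.simple i * cs.simple i * (cs.simple i)⁻¹ = cs.simple i := by simp
  rw [h5, add_left_comm, ← h2, add_zero]

/-- The strong exchange property. -/
theorem mem_rightInvSeq_of_isRightInversion {ω : List B} {t : W}
    (h : cs.IsRightInversion (cs.wordProd ω) t) : t ∈ cs.rightInvSeq ω := by
  classical
  obtain ⟨ht, hlt⟩ := h
  by_contra hmem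
  have h0 : (flipHom cs (cs.wordProd ω) (t, 0)).2 = 0 := by
    rw [flipHom_wordProd, List.count_eq_zero_of_not_mem hmem]; simp
  obtain ⟨ω', hω', he⟩ := cs.exists_isReduced (cs.wordProd ω * t)
  have h1 := flipHom_mul_snd cs (cs.wordProd ω) t t
  rw [flipHom_reflection cs ht, mul_inv_cancel_right, h0, he, flipHom_wordProd] at h1
  have hmem' : t ∈ cs.rightInvSeq ω' := by
    by_contra hn
    rw [List.count_eq_zero_of_not_mem hn] at h1
    simp at h1
  have := (cs.isRightInversion_of_mem_rightInvSeq hω' hmem').2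
  rw [← he, mul_assoc, ht.mul_self, mul_one] at this
  omega

theorem mem_leftInvSeq_of_isLeftInversion {ω : List B} {t : W}
    (h : cs.IsLeftInversion (cs.wordProd ω) t) : t ∈ cs.leftInvSeq ω := by
  rw [← cs.isRightInversion_inv_iff, ← cs.wordProd_reverse] at h
  have := mem_rightInvSeq_of_isRightInversion cs h
  rwa [cs.rightInvSeq_reverse, List.mem_reverse] at this

/-- Exchange for a product of two words: the deleted letter lies in one of the factors. -/
theorem exchange_append (ω₁ ω₂ : List B) {t : W} (ht : cs.IsReflection t)
    (hlt : cs.length (t * (cs.wordProd ω₁ * cs.wordProd ω₂)) <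
      cs.length (cs.wordProd ω₁ * cs.wordProd ω₂)) :
    (t ∈ cs.leftInvSeq ω₁) ∨
      ∃ y, cs.length y < ω₂.length ∧
        t * (cs.wordProd ω₁ * cs.wordProd ω₂) = cs.wordProd ω₁ * y := by
  rw [← cs.wordProd_append] at hlt
  have hm := mem_leftInvSeq_of_isLeftInversion cs ⟨ht, hlt⟩
  obtain ⟨j, hj, hjt⟩ := List.mem_iff_getElem.mp hm
  rw [cs.length_leftInvSeq] at hj
  by_cases hj1 : j < ω₁.length
  · left
    have h2 : cs.leftInvSeq ω₁ = (cs.leftInvSeq (ω₁ ++ ω₂)).take ω₁.length := by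
      rw [← cs.leftInvSeq_take, List.take_left]
    rw [h2, ← hjt, List.mem_iff_getElem]
    exact ⟨j, by simp; omega, by simp⟩
  · right
    have h3 := cs.getD_leftInvSeq_mul_wordProd (ω₁ ++ ω₂) j
    rw [List.getD_eq_getElem _ 1 (by simpa using hj), hjt,
      List.eraseIdx_append_of_length_le (by omega), cs.wordProd_append, cs.wordProd_append] at h3
    rw [List.length_append] at hj
    refine ⟨_, lt_of_le_of_lt (cs.length_wordProd_le _) ?_, h3⟩
    rw [List.length_eraseIdx_of_lt (by omega)]
    omega

theorem length_mul_lt_of_mem_leftInvSeq {ω : List B} (hω : cs.IsReduced ω) {t : W}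
    (ht : t ∈ cs.leftInvSeq ω) : cs.length (t * cs.wordProd ω) < cs.length (cs.wordProd ω) :=
  (cs.isLeftInversion_of_mem_leftInvSeq hω ht).2

/-- A finite Coxeter group has an element of which every element is a prefix. -/
theorem exists_longest [Finite W] :
    ∃ w₀ : W, ∀ a, cs.length w₀ = cs.length a + cs.length (a⁻¹ * w₀) := by
  obtain ⟨w₀, hmax⟩ := Finite.exists_max cs.length
  refine ⟨w₀, fun a => ?_⟩
  obtain ⟨ω, hω, rfl⟩ := cs.exists_isReduced a
  induction ω using List.reverseRecOn with
  | nil => simp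
  | append_singleton ω i ih =>
    have hred : cs.IsReduced ω := by
      have := hω.take ω.length
      rwa [List.take_left] at this
    have ih := ih hred
    have hl : cs.length (cs.wordProd (ω ++ [i])) = cs.length (cs.wordProd ω) + 1 := by
      rw [hω.eq, hred.eq, List.length_append]; rfl
    obtain ⟨ω₂, hω₂, he⟩ := cs.exists_isReduced ((cs.wordProd ω)⁻¹ * w₀)
    have hw₀ : w₀ = cs.wordProd ω * cs.wordProd ω₂ := by rw [← he]; simp
    have ht : cs.IsReflection (cs.wordProd ω * cs.simple i * (cs.wordProd ω)⁻¹) := ⟨_, _, rfl⟩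
    have hlt : cs.length (cs.wordProd ω * cs.simple i * (cs.wordProd ω)⁻¹ * w₀) <
        cs.length w₀ := lt_of_le_of_ne (hmax _) (ht.length_mul_right_ne w₀)
    have hprod : (cs.wordProd (ω ++ [i]))⁻¹ * w₀ = cs.simple i * cs.wordProd ω₂ := by
      rw [hw₀, cs.wordProd_append]; simp [mul_assoc]
    rw [hprod, hl]
    rw [he] at ih
    rw [hw₀] at hlt
    rcases exchange_append cs ω ω₂ ht hlt with h | ⟨y, hy, hty⟩
    · have := length_mul_lt_of_mem_leftInvSeq cs hred h
      rw [inv_mul_cancel_right, ← cs.wordProd_singleton, ← cs.wordProd_append] at this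
      omega
    · have hy' : cs.simple i * cs.wordProd ω₂ = y := by
        have := hty
        simp only [mul_assoc, inv_mul_cancel_left, mul_right_inj] at this
        exact this
      rw [← hω₂.eq] at hy
      rcases cs.length_simple_mul (cs.wordProd ω₂) i with h | h <;> rw [hy'] at h ⊢ <;> omega

end Coxeter

section Geometric

variable {V : Type*} [AddCommGroup V] [Module ℝ V]

/-- The linear map `v ↦ v - f(v) x`. -/
noncomputable def linRefl (f : V →ₗ[ℝ] ℝ) (x : V) : Module.End ℝ V :=
  LinearMap.id - f.smulRight x

theorem linRefl_apply (f : V →ₗ[ℝ] ℝ) (x v : V) : linRefl f x v = v - f v • x := by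
  simp [linRefl]

variable {f g : V →ₗ[ℝ] ℝ} {x y : V} {φ : ℝ}

theorem linRefl_mul_linRefl_comb (hfx : f x = 2) (hgy : g y = 2) (hfy : f y = -2 * Real.cos φ)
    (hgx : g x = -2 * Real.cos φ) (a b : ℝ) :
    (linRefl f x * linRefl g y) (a • x + b • y) =
      (2 * Real.cos φ * (2 * Real.cos φ * a - b) - a) • x + (2 * Real.cos φ * a - b) • y := by
  rw [Module.End.mul_apply, linRefl_apply, linRefl_apply]
  simp only [map_add, map_sub, map_smul, hfx, hgy, hfy, hgx, smul_eq_mul]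
  module

theorem sin_smul_linRefl_pow_left (hfx : f x = 2) (hgy : g y = 2)
    (hfy : f y = -2 * Real.cos φ) (hgx : g x = -2 * Real.cos φ) (k : ℕ) :
    Real.sin φ • ((linRefl f x * linRefl g y) ^ k) x =
      Real.sin ((2 * k + 1) * φ) • x + Real.sin (2 * k * φ) • y := by
  induction k with
  | zero => simp
  | succ k ih =>
    have e1 : Real.sin (2 * (k + 1 : ℕ) * φ) =
        2 * Real.cos φ * Real.sin ((2 * k + 1) * φ) - Real.sin (2 * k * φ) := by
      have h1 : 2 * ((k + 1 : ℕ) : ℝ) * φ = (2 * k + 1) * φ + φ := by push_cast; ring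
      have h2 : 2 * (k : ℝ) * φ = (2 * k + 1) * φ - φ := by ring
      rw [h1, h2, Real.sin_add, Real.sin_sub]; ring
    have e2 : Real.sin ((2 * (k + 1 : ℕ) + 1) * φ) =
        2 * Real.cos φ * Real.sin (2 * (k + 1 : ℕ) * φ) - Real.sin ((2 * k + 1) * φ) := by
      have h1 : (2 * ((k + 1 : ℕ) : ℝ) + 1) * φ = 2 * (k + 1 : ℕ) * φ + φ := by ring
      have h2 : (2 * (k : ℝ) + 1) * φ = 2 * (k + 1 : ℕ) * φ - φ := by push_cast; ring
      rw [h1, h2, Real.sin_add, Real.sin_sub]; ring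
    rw [pow_succ', Module.End.mul_apply, ← map_smul, ih,
      linRefl_mul_linRefl_comb hfx hgy hfy hgx, e2, e1]

theorem sin_smul_linRefl_pow_right (hfx : f x = 2) (hgy : g y = 2)
    (hfy : f y = -2 * Real.cos φ) (hgx : g x = -2 * Real.cos φ) (k : ℕ) :
    Real.sin φ • ((linRefl f x * linRefl g y) ^ k) y =
      (-Real.sin (2 * k * φ)) • x + (-Real.sin ((2 * k - 1) * φ)) • y := by
  induction k with
  | zero => simp
  | succ k ih =>
    have e1 : -Real.sin ((2 * (k + 1 : ℕ) - 1) * φ) =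
        2 * Real.cos φ * (-Real.sin (2 * k * φ)) - -Real.sin ((2 * k - 1) * φ) := by
      have h1 : (2 * ((k + 1 : ℕ) : ℝ) - 1) * φ = 2 * k * φ + φ := by push_cast; ring
      have h2 : (2 * (k : ℝ) - 1) * φ = 2 * k * φ - φ := by ring
      rw [h1, h2, Real.sin_add, Real.sin_sub]; ring
    have e2 : -Real.sin (2 * (k + 1 : ℕ) * φ) =
        2 * Real.cos φ * (-Real.sin ((2 * (k + 1 : ℕ) - 1) * φ)) - -Real.sin (2 * k * φ) := by
      have h1 : 2 * ((k + 1 : ℕ) : ℝ) * φ = (2 * (k + 1 : ℕ) - 1) * φ + φ := by ring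
      have h2 : 2 * (k : ℝ) * φ = (2 * (k + 1 : ℕ) - 1) * φ - φ := by push_cast; ring
      rw [h1, h2, Real.sin_add, Real.sin_sub]; ring
    rw [pow_succ', Module.End.mul_apply, ← map_smul, ih,
      linRefl_mul_linRefl_comb hfx hgy hfy hgx, e2, e1]

theorem linRefl_pow_eq_one (hfx : f x = 2) (hgy : g y = 2)
    (hfy : f y = -2 * Real.cos φ) (hgx : g x = -2 * Real.cos φ) (hs : Real.sin φ ≠ 0)
    {m : ℕ} (hm : m * φ = Real.pi) : (linRefl f x * linRefl g y) ^ m = 1 := by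
  have hx : ((linRefl f x * linRefl g y) ^ m) x = x := by
    have h := sin_smul_linRefl_pow_left hfx hgy hfy hgx m
    rw [show (2 * (m : ℝ) + 1) * φ = φ + 2 * Real.pi by rw [← hm]; ring,
      show 2 * (m : ℝ) * φ = 2 * Real.pi by rw [← hm]; ring, Real.sin_add_two_pi,
      Real.sin_two_pi, zero_smul, add_zero] at h
    exact smul_right_injective V hs h
  have hy : ((linRefl f x * linRefl g y) ^ m) y = y := by
    have h := sin_smul_linRefl_pow_right hfx hgy hfy hgx m
    rw [show (2 * (m : ℝ) - 1) * φ = -φ + 2 * Real.pi by rw [← hm]; ring,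
      show 2 * (m : ℝ) * φ = 2 * Real.pi by rw [← hm]; ring, Real.sin_add_two_pi,
      Real.sin_two_pi, neg_zero, zero_smul, zero_add, Real.sin_neg, neg_neg] at h
    exact smul_right_injective V hs h
  have hfix : ∀ u, f u = 0 → g u = 0 → ((linRefl f x * linRefl g y) ^ m) u = u := by
    intro u hf hg
    have h1 : (linRefl f x * linRefl g y) u = u := by
      simp [Module.End.mul_apply, linRefl_apply, hf, hg]
    clear hm hx hy
    induction m with
    | zero => simp
    | succ m ih => rw [pow_succ, Module.End.mul_apply, h1, ih]
  ext z
  have hc := Real.sin_sq_add_cos_sq φ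
  set c := Real.cos φ
  set a := (f z + c * g z) / (2 * Real.sin φ ^ 2) with ha
  set b := (g z + c * f z) / (2 * Real.sin φ ^ 2) with hb
  have hz : z = (z - a • x - b • y) + a • x + b • y := by module
  have hc' : c ^ 2 = 1 - Real.sin φ ^ 2 := by linarith
  have h1 : f (z - a • x - b • y) = 0 := by
    simp only [map_sub, map_smul, hfx, hfy, smul_eq_mul, ha, hb]
    field_simp
    linear_combination f z * hc'
  have h2 : g (z - a • x - b • y) = 0 := by
    simp only [map_sub, map_smul, hgx, hgy, smul_eq_mul, ha, hb]
    field_simp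
    linear_combination g z * hc'
  rw [hz, map_add, map_add, hfix _ h1 h2, map_smul, map_smul, hx, hy]
  rfl

end Geometric

section Order

variable (M : CoxeterMatrix B)

/-- The linear form `2 B(α_i, ·)` of the geometric representation. -/
noncomputable def coform (i : B) : (B →₀ ℝ) →ₗ[ℝ] ℝ :=
  Finsupp.linearCombination ℝ fun j => -2 * Real.cos (Real.pi / M i j)

theorem coform_single (i j : B) :
    coform M i (Finsupp.single j 1) = -2 * Real.cos (Real.pi / M i j) := by
  simp [coform]

theorem coform_self (i : B) : coform M i (Finsupp.single i 1) = 2 := by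
  simp [coform_single]

theorem sin_pi_div_pos {m : ℕ} (hm : 2 ≤ m) : 0 < Real.sin (Real.pi / m) := by
  have : (2 : ℝ) ≤ m := by exact_mod_cast hm
  apply Real.sin_pos_of_pos_of_lt_pi (by positivity)
  exact div_lt_self Real.pi_pos (by linarith)

theorem isLiftable_linRefl :
    M.IsLiftable fun i => linRefl (coform M i) (Finsupp.single i (1 : ℝ)) := by
  intro i j
  by_cases hij : i = j
  · subst hij
    rw [M.diagonal, pow_one]
    refine LinearMap.ext fun v => ?_
    rw [Module.End.mul_apply, linRefl_apply, linRefl_apply, map_sub, map_smul, coform_self]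
    simp only [Module.End.one_apply, smul_eq_mul]
    module
  · by_cases h0 : M i j = 0
    · rw [h0, pow_zero]
    · have h2 : 2 ≤ M i j := by have := M.off_diagonal i j hij; omega
      refine linRefl_pow_eq_one (φ := Real.pi / M i j) (coform_self M i) (coform_self M j)
        (coform_single M i j) ?_ (sin_pi_div_pos h2).ne' (by field_simp)
      rw [coform_single, M.symmetric]

/-- In a Coxeter group the product of two distinct simple reflections has order `m_{i,j}`. -/
theorem le_of_simple_mul_simple_pow_eq_one {W : Type*} [Group W] {M : CoxeterMatrix B}
    (cs : CoxeterSystem M W) {i j : B} (hij : i ≠ j) {k : ℕ} (hk : 0 < k)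
    (h : (cs.simple i * cs.simple j) ^ k = 1) : M i j ≠ 0 ∧ M i j ≤ k := by
  have hρ := congrArg (cs.lift ⟨_, isLiftable_linRefl M⟩) h
  rw [map_pow, map_mul, cs.lift_apply_simple, cs.lift_apply_simple, map_one] at hρ
  have hfy := coform_single M i j
  have hgx := coform_single M j i
  rw [M.symmetric j i] at hgx
  by_cases h0 : M i j = 0
  · exfalso
    simp only [h0, Nat.cast_zero, div_zero, Real.cos_zero] at hfy hgx
    have key : ∀ n : ℕ, ((linRefl (coform M i) (Finsupp.single i (1 : ℝ)) *
        linRefl (coform M j) (Finsupp.single j (1 : ℝ))) ^ n) (Finsupp.single i 1) =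
        (2 * n + 1 : ℝ) • Finsupp.single i (1 : ℝ) + (2 * n : ℝ) • Finsupp.single j (1 : ℝ) := by
      intro n
      induction n with
      | zero => simp
      | succ n ih =>
        rw [pow_succ', Module.End.mul_apply, ih, linRefl_mul_linRefl_comb (φ := 0)
          (coform_self M i) (coform_self M j) (by simpa using hfy) (by simpa using hgx)]
        simp only [Real.cos_zero]
        push_cast
        module
    have := key k
    rw [hρ] at this
    have := DFunLike.congr_fun this j
    simp [hij] at this
    omega
  · refine ⟨h0, ?_⟩
    by_contra! hlt
    have h2 : 2 ≤ M i j := by have := M.off_diagonal i j hij; omega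
    have hpos := sin_pi_div_pos h2
    have hs := sin_smul_linRefl_pow_left (coform_self M i) (coform_self M j) hfy hgx k
    rw [hρ] at hs
    have hi := DFunLike.congr_fun hs i
    have hj := DFunLike.congr_fun hs j
    simp [hij, Ne.symm hij] at hi hj
    set φ := Real.pi / M i j with hφ
    have hm0 : (0 : ℝ) < M i j := by exact_mod_cast Nat.pos_of_ne_zero h0
    have hk0 : (0 : ℝ) < k := by exact_mod_cast hk
    have hklt : (k : ℝ) < M i j := by exact_mod_cast hlt
    have hmφ : M i j * φ = Real.pi := by rw [hφ]; field_simp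
    have hφ0 : 0 < φ := by positivity
    have hcos : Real.cos (2 * k * φ) = 1 := by
      have : Real.sin ((2 * k + 1) * φ) =
          Real.sin (2 * k * φ) * Real.cos φ + Real.cos (2 * k * φ) * Real.sin φ := by
        rw [← Real.sin_add]; ring_nf
      rw [this, ← hj, zero_mul, zero_add] at hi
      exact (mul_right_cancel₀ hpos.ne' (by linarith)).symm
    have := (Real.cos_eq_one_iff_of_lt_of_lt (x := 2 * k * φ)
      (by nlinarith [Real.pi_pos, mul_pos hk0 hφ0]) (by nlinarith)).mp hcos
    nlinarith [mul_pos hk0 hφ0]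

end Order

section DihedralGroup

variable {W : Type*} [Group W] {M : CoxeterMatrix B} (cs : CoxeterSystem M W)

theorem length_altList (s t : B) (k : ℕ) : (altList s t k).length = k := by
  induction k generalizing s t with
  | zero => rfl
  | succ k ih => simp [altList, ih]

theorem mem_leftInvSeq_altList {s t : B} {k : ℕ} {x : W}
    (h : x ∈ cs.leftInvSeq (altList s t k)) :
    ∃ j < k, x = (cs.simple s * cs.simple t) ^ j * cs.simple s := by
  induction k generalizing s t x with
  | zero => simp [altList] at h
  | succ k ih =>
    rw [altList, CoxeterSystem.leftInvSeq, List.mem_cons, List.mem_map] at h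
    rcases h with rfl | ⟨y, hy, rfl⟩
    · exact ⟨0, by omega, by simp⟩
    · obtain ⟨j, hj, rfl⟩ := ih hy
      refine ⟨j + 1, by omega, ?_⟩
      have hc : ∀ n : ℕ, cs.simple s * (cs.simple t * cs.simple s) ^ n =
          (cs.simple s * cs.simple t) ^ n * cs.simple s := by
        intro n
        induction n with
        | zero => simp
        | succ n ihn => rw [pow_succ, ← mul_assoc, ihn, pow_succ]; simp [mul_assoc]
      simp only [MulAut.conj_apply, cs.inv_simple]
      rw [← mul_assoc, hc, pow_succ]
      simp [mul_assoc]

/-- An alternating prefix shorter than the braid relation extends when both of its letters are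
left descents. -/
theorem exists_eq_altList_mul {w : W} {s t : B} (hst : s ≠ t) (hs : cs.IsLeftDescent w s)
    (ht : cs.IsLeftDescent w t) {k : ℕ} (hk : M s t = 0 ∨ k ≤ M s t) :
    ∃ z, w = cs.wordProd (altList s t k) * z ∧ cs.length w = k + cs.length z := by
  induction k generalizing s t with
  | zero => exact ⟨w, by simp [altList]⟩
  | succ k ih =>
    obtain ⟨z, hz, hl⟩ := ih hst.symm ht hs (by rw [M.symmetric]; omega)
    obtain ⟨ω, hω, rfl⟩ := cs.exists_isReduced z
    have hlt := hs
    rw [CoxeterSystem.IsLeftDescent, hz] at hlt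
    rcases exchange_append cs _ _ (cs.isReflection_simple s) hlt with h | ⟨y, hy, he⟩
    · exfalso
      obtain ⟨j, hj, he⟩ := mem_leftInvSeq_altList cs h
      have hp : (cs.simple t * cs.simple s) ^ (j + 1) = 1 := by
        rw [pow_succ, ← mul_assoc, ← he, cs.simple_mul_simple_self]
      have := le_of_simple_mul_simple_pow_eq_one cs hst.symm (Nat.succ_pos j) hp
      rw [M.symmetric t s] at this
      omega
    · rw [← hz] at he
      have hw : w = cs.wordProd (altList s t (k + 1)) * y := by
        rw [altList, cs.wordProd_cons, mul_assoc, ← he, cs.simple_mul_simple_cancel_left]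
      refine ⟨y, hw, ?_⟩
      have h1 : cs.length w ≤ (k + 1) + cs.length y := by
        nth_rewrite 1 [hw]
        refine (cs.length_mul_le _ _).trans (Nat.add_le_add_right ?_ _)
        exact (cs.length_wordProd_le _).trans (length_altList s t (k + 1)).le
      rw [← hω.eq] at hy
      omega

/-- If `s ≠ t` are left descents of `w`, then the longest element of the dihedral group
generated by `s` and `t` is a left divisor of `w`. -/
theorem exists_eq_braid_mul {w : W} {s t : B} (hst : s ≠ t) (hs : cs.IsLeftDescent w s)
    (ht : cs.IsLeftDescent w t) :
    M s t ≠ 0 ∧ ∃ z, w = cs.wordProd (altList s t (M s t)) * z ∧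
      cs.length w = M s t + cs.length z := by
  refine ⟨fun h0 => ?_, exists_eq_altList_mul cs hst hs ht (Or.inr le_rfl)⟩
  obtain ⟨z, -, hz⟩ := exists_eq_altList_mul cs hst hs ht (k := cs.length w + 1) (Or.inl h0)
  omega

end DihedralGroup

section BraidMonoid

variable (M : CoxeterMatrix B)

/-- The braid relations, between positive words. -/
def braidStep (x y : FreeMonoid B) : Prop :=
  ∃ s t : B, s ≠ t ∧ M s t ≠ 0 ∧ x = FreeMonoid.ofList (altList s t (M s t)) ∧
    y = FreeMonoid.ofList (altList t s (M s t))

/-- The Artin-Tits monoid, presented by the braid relations. -/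
abbrev BraidMonoid : Type _ := PresentedMonoid (braidStep M)

/-- The standard generators of the Artin-Tits monoid. -/
def sig (s : B) : BraidMonoid M := PresentedMonoid.of _ s

/-- The element of the Artin-Tits monoid represented by a positive word. -/
def wd (l : List B) : BraidMonoid M := (l.map (sig M)).prod

@[simp] theorem wd_nil : wd M [] = 1 := rfl

@[simp] theorem wd_cons (s : B) (l : List B) : wd M (s :: l) = sig M s * wd M l := by simp [wd]

@[simp] theorem wd_append (l l' : List B) : wd M (l ++ l') = wd M l * wd M l' := by simp [wd]

theorem mk_eq_wd (x : FreeMonoid B) :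
    PresentedMonoid.mk (braidStep M) x = wd M (FreeMonoid.toList x) := by
  induction x using FreeMonoid.inductionOn' with
  | one => rfl
  | of_mul s x ih => rw [map_mul, ih]; simp [sig, PresentedMonoid.of]

theorem wd_surjective : Function.Surjective (wd M) := by
  intro x
  obtain ⟨l, rfl⟩ := PresentedMonoid.surjective_mk x
  exact ⟨_, (mk_eq_wd M l).symm⟩

theorem wd_braid {s t : B} (hst : s ≠ t) (h0 : M s t ≠ 0) :
    wd M (altList s t (M s t)) = wd M (altList t s (M s t)) := by
  have := PresentedMonoid.mk_eq_mk_of_rel (rels := braidStep M) ⟨s, t, hst, h0, rfl, rfl⟩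
  simpa [mk_eq_wd] using this

theorem altList_pred (s t : B) {m : ℕ} (hm : m ≠ 0) : altList s t m = s :: altList t s (m - 1) := by
  obtain ⟨k, rfl⟩ := Nat.exists_eq_succ_of_ne_zero hm
  rfl

/-- The length morphism on the Artin-Tits monoid. -/
def lenHom : BraidMonoid M →* Multiplicative ℕ :=
  PresentedMonoid.lift (fun _ => Multiplicative.ofAdd 1) (by
    rintro x y ⟨s, t, -, -, rfl, rfl⟩
    have : ∀ l : List B, FreeMonoid.lift (fun _ : B => Multiplicative.ofAdd 1)
        (FreeMonoid.ofList l) = Multiplicative.ofAdd l.length := by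
      intro l
      simp [FreeMonoid.lift_apply, ← ofAdd_nsmul]
    rw [this, this, length_altList, length_altList])

/-- The length of an element of the Artin-Tits monoid. -/
def plen (x : BraidMonoid M) : ℕ := Multiplicative.toAdd (lenHom M x)

variable {M}

@[simp] theorem plen_mul (x y : BraidMonoid M) : plen M (x * y) = plen M x + plen M y := by
  simp [plen]

@[simp] theorem plen_one : plen M 1 = 0 := by simp [plen]

@[simp] theorem plen_sig (s : B) : plen M (sig M s) = 1 := rfl

@[simp] theorem plen_wd (l : List B) : plen M (wd M l) = l.length := by
  induction l with
  | nil => simp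
  | cons s l ih => simp [ih, add_comm]

theorem eq_one_or_eq_sig_mul (x : BraidMonoid M) : x = 1 ∨ ∃ s y, x = sig M s * y := by
  obtain ⟨l, rfl⟩ := wd_surjective M x
  cases l with
  | nil => exact Or.inl rfl
  | cons s l => exact Or.inr ⟨s, _, wd_cons M s l⟩

theorem exists_eq_sig_of_plen_eq_one {x : BraidMonoid M} (h : plen M x = 1) :
    ∃ s, x = sig M s := by
  obtain ⟨l, rfl⟩ := wd_surjective M x
  rw [plen_wd, List.length_eq_one_iff] at h
  obtain ⟨s, rfl⟩ := h
  exact ⟨s, by simp⟩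

end BraidMonoid

section Lift

variable {W : Type*} [Group W] {M : CoxeterMatrix B} (cs : CoxeterSystem M W)

theorem wordProd_altList_braid (s t : B) :
    cs.wordProd (altList s t (M s t)) = cs.wordProd (altList t s (M s t)) := by
  have hb := cs.wordProd_braidWord_eq t s
  rw [CoxeterSystem.braidWord, CoxeterSystem.braidWord, M.symmetric t s] at hb
  rw [altList_eq_reverse_alternatingWord, altList_eq_reverse_alternatingWord,
    cs.wordProd_reverse, cs.wordProd_reverse, hb]

theorem isReduced_of_cons {s : B} {l : List B} (h : cs.IsReduced (s :: l)) : cs.IsReduced l := by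
  simpa using h.drop 1

/-- Matsumoto's theorem: reduced words of the same element are braid equivalent. -/
theorem wd_eq_of_wordProd_eq {l l' : List B} (h : cs.IsReduced l) (h' : cs.IsReduced l')
    (he : cs.wordProd l = cs.wordProd l') : wd M l = wd M l' := by
  induction hn : l.length generalizing l l' with
  | zero =>
    have h0 : l'.length = 0 := by rw [← h'.eq, ← he, h.eq, hn]
    rw [List.length_eq_zero_iff] at hn h0
    rw [hn, h0]
  | succ n ih =>
    have hn' : l'.length = n + 1 := by rw [← h'.eq, ← he, h.eq, hn]
    obtain ⟨s, l, rfl⟩ := List.exists_cons_of_length_eq_add_one hn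
    obtain ⟨t, l', rfl⟩ := List.exists_cons_of_length_eq_add_one hn'
    have hl := isReduced_of_cons cs h
    have hl' := isReduced_of_cons cs h'
    simp only [List.length_cons, Nat.add_right_cancel_iff] at hn hn'
    by_cases hst : s = t
    · subst hst
      rw [cs.wordProd_cons, cs.wordProd_cons, mul_right_inj] at he
      rw [wd_cons, wd_cons, ih hl hl' he hn]
    · have hlen : cs.length (cs.wordProd (s :: l)) = n + 1 := by rw [h.eq]; simp [hn]
      have e1 : cs.wordProd l = cs.simple s * cs.wordProd (s :: l) := by
        rw [cs.wordProd_cons, cs.simple_mul_simple_cancel_left]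
      have e2 : cs.wordProd l' = cs.simple t * cs.wordProd (s :: l) := by
        rw [he, cs.wordProd_cons, cs.simple_mul_simple_cancel_left]
      have hs : cs.IsLeftDescent (cs.wordProd (s :: l)) s := by
        rw [CoxeterSystem.IsLeftDescent, ← e1, hlen, hl.eq, hn]; omega
      have ht : cs.IsLeftDescent (cs.wordProd (s :: l)) t := by
        rw [CoxeterSystem.IsLeftDescent, ← e2, hlen, hl'.eq, hn']; omega
      obtain ⟨h0, z, hz, hzl⟩ := exists_eq_braid_mul cs hst hs ht
      obtain ⟨ζ, hζ, rfl⟩ := cs.exists_isReduced z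
      rw [hlen, hζ.eq] at hzl
      have f1 : cs.wordProd l = cs.wordProd (altList t s (M s t - 1) ++ ζ) := by
        rw [e1, hz, altList_pred s t h0, cs.wordProd_cons, cs.wordProd_append, mul_assoc,
          cs.simple_mul_simple_cancel_left]
      have f2 : cs.wordProd l' = cs.wordProd (altList s t (M s t - 1) ++ ζ) := by
        rw [e2, hz, wordProd_altList_braid, altList_pred t s h0, cs.wordProd_cons,
          cs.wordProd_append, mul_assoc, cs.simple_mul_simple_cancel_left]
      have r1 : cs.IsReduced (altList t s (M s t - 1) ++ ζ) := by
        rw [CoxeterSystem.IsReduced, ← f1, hl.eq, List.length_append, length_altList]; omega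
      have r2 : cs.IsReduced (altList s t (M s t - 1) ++ ζ) := by
        rw [CoxeterSystem.IsReduced, ← f2, hl'.eq, List.length_append, length_altList]; omega
      rw [wd_cons, wd_cons, ih hl r1 f1 hn, ih hl' r2 f2 hn', wd_append, wd_append, ← mul_assoc,
        ← mul_assoc, ← wd_cons, ← wd_cons, ← altList_pred s t h0, ← altList_pred t s h0,
        wd_braid M hst h0]

/-- The canonical lift of a Coxeter group to the Artin-Tits monoid. -/
noncomputable def lft (w : W) : BraidMonoid M := wd M (cs.exists_isReduced w).choose

theorem lft_wordProd {l : List B} (h : cs.IsReduced l) : lft cs (cs.wordProd l) = wd M l :=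
  have hc := (cs.exists_isReduced (cs.wordProd l)).choose_spec
  wd_eq_of_wordProd_eq cs hc.1 h hc.2.symm

theorem lft_mul {u v : W} (h : cs.length (u * v) = cs.length u + cs.length v) :
    lft cs (u * v) = lft cs u * lft cs v := by
  obtain ⟨l, hl, rfl⟩ := cs.exists_isReduced u
  obtain ⟨l', hl', rfl⟩ := cs.exists_isReduced v
  have hr : cs.IsReduced (l ++ l') := by
    rw [CoxeterSystem.IsReduced, cs.wordProd_append, h, hl.eq, hl'.eq, List.length_append]
  rw [← cs.wordProd_append, lft_wordProd cs hr, lft_wordProd cs hl, lft_wordProd cs hl', wd_append]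

@[simp] theorem lft_one : lft cs 1 = 1 := by
  have : cs.IsReduced [] := by simp [CoxeterSystem.IsReduced]
  simpa using lft_wordProd cs this

theorem lft_simple (s : B) : lft cs (cs.simple s) = sig M s := by
  have : cs.IsReduced [s] := by simp [CoxeterSystem.IsReduced]
  simpa using lft_wordProd cs this

theorem lft_eq_sig_mul {w : W} {s : B} (h : cs.IsLeftDescent w s) :
    lft cs w = sig M s * lft cs (cs.simple s * w) := by
  rw [cs.isLeftDescent_iff] at h
  rw [← lft_simple cs, ← lft_mul cs, cs.simple_mul_simple_cancel_left]
  rw [cs.simple_mul_simple_cancel_left, cs.length_simple]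
  omega

/-- The prefix order (right weak order) on a Coxeter group. -/
def WeakLE (a z : W) : Prop := cs.length z = cs.length a + cs.length (a⁻¹ * z)

variable {cs}

theorem WeakLE.one (z : W) : WeakLE cs 1 z := by simp [WeakLE]

theorem WeakLE.refl (z : W) : WeakLE cs z z := by simp [WeakLE]

theorem WeakLE.trans {a b c : W} (h : WeakLE cs a b) (h' : WeakLE cs b c) : WeakLE cs a c := by
  have h1 := cs.length_mul_le a (a⁻¹ * c)
  have h2 := cs.length_mul_le (a⁻¹ * b) (b⁻¹ * c)
  have e : a⁻¹ * b * (b⁻¹ * c) = a⁻¹ * c := by group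
  rw [mul_inv_cancel_left] at h1
  rw [e] at h2
  unfold WeakLE at *
  omega

theorem weakLE_simple_iff {s : B} {z : W} :
    WeakLE cs (cs.simple s) z ↔ cs.IsLeftDescent z s := by
  rw [WeakLE, cs.isLeftDescent_iff, cs.inv_simple, cs.length_simple]
  omega

theorem WeakLE.isLeftDescent {s : B} {a z : W} (h : WeakLE cs a z) (ha : cs.IsLeftDescent a s) :
    cs.IsLeftDescent z s :=
  weakLE_simple_iff.mp ((weakLE_simple_iff.mpr ha).trans h)

theorem weakLE_simple_mul_iff {s : B} {a z : W} (ha : cs.IsLeftDescent a s)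
    (hz : cs.IsLeftDescent z s) :
    WeakLE cs (cs.simple s * a) (cs.simple s * z) ↔ WeakLE cs a z := by
  rw [cs.isLeftDescent_iff] at ha hz
  have e : (cs.simple s * a)⁻¹ * (cs.simple s * z) = a⁻¹ * z := by simp [mul_assoc]
  rw [WeakLE, WeakLE, e]
  omega

theorem lft_eq_mul_of_weakLE {a z : W} (h : WeakLE cs a z) :
    lft cs z = lft cs a * lft cs (a⁻¹ * z) := by
  rw [← lft_mul cs, mul_inv_cancel_left]
  rw [mul_inv_cancel_left]; exact h

theorem isReduced_altList {w : W} {s t : B} (hst : s ≠ t)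
    (hs : cs.IsLeftDescent w s) (ht : cs.IsLeftDescent w t) :
    cs.IsReduced (altList s t (M s t)) := by
  obtain ⟨-, z, hz, hl⟩ := exists_eq_braid_mul cs hst hs ht
  have h1 := cs.length_mul_le (cs.wordProd (altList s t (M s t))) z
  have h2 := cs.length_wordProd_le (altList s t (M s t))
  rw [CoxeterSystem.IsReduced]
  rw [← hz] at h1
  rw [length_altList] at *
  omega

end Lift

section Diamond

variable {W : Type*} [Group W] {M : CoxeterMatrix B} {cs : CoxeterSystem M W}

/-- The conclusion that `sig s * u = sig t * v` ought to have: either `s = t` and `u = v`, or both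
sides are a multiple of the lcm of `s` and `t`, compatibly. -/
def Diamond (s t : B) (u v : BraidMonoid M) : Prop :=
  (s = t ∧ u = v) ∨ (s ≠ t ∧ M s t ≠ 0 ∧ ∃ w, u = wd M (altList t s (M s t - 1)) * w ∧
    v = wd M (altList s t (M s t - 1)) * w)

variable (M) in
/-- Equalities `sig s * u = sig t * v` with `u` shorter than `N` are as expected. -/
def DiamondBelow (N : ℕ) : Prop :=
  ∀ (s t : B) (u v : BraidMonoid M), sig M s * u = sig M t * v → plen M u < N → Diamond s t u v

theorem Diamond.symm {s t : B} {u v : BraidMonoid M} (h : Diamond s t u v) : Diamond t s v u := by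
  rcases h with ⟨rfl, rfl⟩ | ⟨hst, h0, w, hu, hv⟩
  · exact Or.inl ⟨rfl, rfl⟩
  · refine Or.inr ⟨hst.symm, ?_⟩
    rw [M.symmetric t s]
    exact ⟨h0, w, hv, hu⟩

theorem Diamond.mul_right {s t : B} {u v : BraidMonoid M} (h : Diamond s t u v)
    (y : BraidMonoid M) : Diamond s t (u * y) (v * y) := by
  rcases h with ⟨rfl, rfl⟩ | ⟨hst, h0, w, rfl, rfl⟩
  · exact Or.inl ⟨rfl, rfl⟩
  · exact Or.inr ⟨hst, h0, w * y, mul_assoc .., mul_assoc ..⟩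

theorem DiamondBelow.sig_mul_left_cancel {N : ℕ} (hK : DiamondBelow M N) {s : B}
    {u v : BraidMonoid M} (h : sig M s * u = sig M s * v) (hu : plen M u < N) : u = v := by
  rcases hK s s u v h hu with ⟨-, rfl⟩ | ⟨h, -⟩
  · rfl
  · exact absurd rfl h

theorem DiamondBelow.wd_mul_left_cancel {N : ℕ} (hK : DiamondBelow M N) {l : List B}
    {u v : BraidMonoid M} (h : wd M l * u = wd M l * v) (hu : plen M (wd M l * u) ≤ N) :
    u = v := by
  induction l with
  | nil => simpa using h
  | cons s l ih =>
    rw [wd_cons, mul_assoc, mul_assoc] at h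
    rw [wd_cons, mul_assoc, plen_mul, plen_sig] at hu
    exact ih (hK.sig_mul_left_cancel h (by omega)) (by omega)

theorem not_isLeftDescent_of_weakLE {s : B} {v z : W} (hz : cs.IsLeftDescent z s)
    (h : WeakLE cs v (cs.simple s * z)) : ¬ cs.IsLeftDescent v s := fun hv => by
  have h1 := h.isLeftDescent hv
  rw [CoxeterSystem.IsLeftDescent, cs.simple_mul_simple_cancel_left] at h1
  exact lt_asymm h1 hz

theorem isLeftDescent_simple_mul {s : B} {v : W} (hv : ¬ cs.IsLeftDescent v s) :
    cs.IsLeftDescent (cs.simple s * v) s := by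
  rw [cs.not_isLeftDescent_iff] at hv
  rw [CoxeterSystem.IsLeftDescent, cs.simple_mul_simple_cancel_left]
  omega

theorem exists_lft_simple_mul {z : W} {s t : B} (hst : s ≠ t) (hs : cs.IsLeftDescent z s)
    (ht : cs.IsLeftDescent z t) :
    M s t ≠ 0 ∧ ∃ c, lft cs (cs.simple s * z) = wd M (altList t s (M s t - 1)) * lft cs c ∧
      lft cs (cs.simple t * z) = wd M (altList s t (M s t - 1)) * lft cs c := by
  obtain ⟨h0, c, hz, hl⟩ := exists_eq_braid_mul cs hst hs ht
  refine ⟨h0, c, ?_, ?_⟩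
  · have hr := isReduced_altList hst hs ht
    rw [altList_pred s t h0] at hr
    have hr := isReduced_of_cons cs hr
    rw [cs.isLeftDescent_iff] at hs
    have e : cs.simple s * z = cs.wordProd (altList t s (M s t - 1)) * c := by
      rw [hz, altList_pred s t h0, cs.wordProd_cons, mul_assoc, cs.simple_mul_simple_cancel_left]
    rw [e] at hs ⊢
    rw [lft_mul cs, lft_wordProd cs hr]
    rw [hr.eq, length_altList]; omega
  · have hr := isReduced_altList hst.symm ht hs
    rw [M.symmetric t s, altList_pred t s h0] at hr
    have hr := isReduced_of_cons cs hr
    rw [cs.isLeftDescent_iff] at ht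
    have e : cs.simple t * z = cs.wordProd (altList s t (M s t - 1)) * c := by
      rw [hz, wordProd_altList_braid, altList_pred t s h0, cs.wordProd_cons, mul_assoc,
        cs.simple_mul_simple_cancel_left]
    rw [e] at ht ⊢
    rw [lft_mul cs, lft_wordProd cs hr]
    rw [hr.eq, length_altList]; omega

theorem isLeftDescent_wordProd_altList {z : W} {s t : B} (hst : s ≠ t)
    (hs : cs.IsLeftDescent z s) (ht : cs.IsLeftDescent z t) :
    cs.IsLeftDescent (cs.wordProd (altList s t (M s t))) s := by
  obtain ⟨h0, -⟩ := exists_eq_braid_mul cs hst hs ht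
  have hr := isReduced_altList hst hs ht
  rw [CoxeterSystem.IsLeftDescent, hr.eq]
  rw [altList_pred s t h0] at hr ⊢
  have hr' := isReduced_of_cons cs hr
  rw [cs.wordProd_cons, cs.simple_mul_simple_cancel_left, hr'.eq]
  simp

theorem weakLE_wordProd_altList {z : W} {s t : B} (hst : s ≠ t)
    (hs : cs.IsLeftDescent z s) (ht : cs.IsLeftDescent z t) :
    WeakLE cs (cs.wordProd (altList s t (M s t))) z := by
  obtain ⟨-, c, hc, hl⟩ := exists_eq_braid_mul cs hst hs ht
  have hr := isReduced_altList hst hs ht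
  rw [WeakLE, hr.eq, length_altList, hl]
  conv_rhs => rw [hc, inv_mul_cancel_left]

/-- `v` is a least upper bound of `a` and `b` for the prefix order, whose lift divides `x`. -/
def IsLubUnder (cs : CoxeterSystem M W) (x : BraidMonoid M) (a b v : W) : Prop :=
  WeakLE cs a v ∧ WeakLE cs b v ∧ lft cs v ∣ x ∧ ∀ z, WeakLE cs a z → WeakLE cs b z → WeakLE cs v z

theorem exists_isLubUnder_of_common_descent {N : ℕ} (hK : DiamondBelow M N) {w₀ : W}
    (hw₀ : ∀ a, WeakLE cs a w₀) {x : BraidMonoid M} (hx : plen M x ≤ N)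
    (ih : ∀ x', plen M x' < plen M x → ∀ a b : W, lft cs a ∣ x' → lft cs b ∣ x' →
      ∃ v, IsLubUnder cs x' a b v)
    {a b : W} {s : B} (ha : cs.IsLeftDescent a s) (hb : cs.IsLeftDescent b s)
    (hax : lft cs a ∣ x) (hbx : lft cs b ∣ x) : ∃ v, IsLubUnder cs x a b v := by
  obtain ⟨c, hc⟩ := hax
  obtain ⟨d, hd⟩ := hbx
  rw [lft_eq_sig_mul cs ha, mul_assoc] at hc
  rw [lft_eq_sig_mul cs hb, mul_assoc] at hd
  have hlen : plen M x = 1 + plen M (lft cs (cs.simple s * a) * c) := by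
    rw [hc, plen_mul, plen_sig]
  have he := hK.sig_mul_left_cancel (hc.symm.trans hd) (by omega)
  obtain ⟨v, hav, hbv, hvx, hv⟩ := ih _ (by omega) (cs.simple s * a) (cs.simple s * b)
    ⟨c, rfl⟩ ⟨d, he⟩
  have hs₀ : cs.IsLeftDescent w₀ s := (hw₀ a).isLeftDescent ha
  have hvs : ¬ cs.IsLeftDescent v s := not_isLeftDescent_of_weakLE hs₀
    (hv _ ((weakLE_simple_mul_iff ha hs₀).mpr (hw₀ a)) ((weakLE_simple_mul_iff hb hs₀).mpr (hw₀ b)))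
  have hsv := isLeftDescent_simple_mul hvs
  refine ⟨cs.simple s * v, ?_, ?_, ?_, fun z haz hbz => ?_⟩
  · rwa [← weakLE_simple_mul_iff ha hsv, cs.simple_mul_simple_cancel_left]
  · rwa [← weakLE_simple_mul_iff hb hsv, cs.simple_mul_simple_cancel_left]
  · rw [lft_eq_sig_mul cs hsv, cs.simple_mul_simple_cancel_left, hc]
    exact mul_dvd_mul_left _ hvx
  · have hz := haz.isLeftDescent ha
    rw [← weakLE_simple_mul_iff hsv hz, cs.simple_mul_simple_cancel_left]
    exact hv _ ((weakLE_simple_mul_iff ha hz).mpr haz) ((weakLE_simple_mul_iff hb hz).mpr hbz)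

theorem Diamond.wd_dvd {s t : B} {u v : BraidMonoid M} (h : Diamond s t u v) (hst : s ≠ t) :
    wd M (altList s t (M s t)) ∣ sig M s * u := by
  rcases h with ⟨rfl, rfl⟩ | ⟨-, h0, w, rfl, rfl⟩
  · exact absurd rfl hst
  · exact ⟨w, by rw [altList_pred s t h0, wd_cons, mul_assoc]⟩

theorem exists_isLubUnder {N : ℕ} (hK : DiamondBelow M N) {w₀ : W}
    (hw₀ : ∀ a, WeakLE cs a w₀) (x : BraidMonoid M) (hx : plen M x ≤ N) (a b : W)
    (hax : lft cs a ∣ x) (hbx : lft cs b ∣ x) : ∃ v, IsLubUnder cs x a b v := by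
  induction hn : plen M x using Nat.strong_induction_on generalizing x a b with
  | _ n ih =>
    subst hn
    have ih' : ∀ x', plen M x' < plen M x → ∀ a b : W, lft cs a ∣ x' → lft cs b ∣ x' →
        ∃ v, IsLubUnder cs x' a b v := fun x' hx' a b h h' =>
      ih _ hx' x' (by omega) a b h h' rfl
    by_cases ha : a = 1
    · subst ha
      exact ⟨b, WeakLE.one b, WeakLE.refl b, hbx, fun z _ h => h⟩
    by_cases hb : b = 1
    · subst hb
      exact ⟨a, WeakLE.refl a, WeakLE.one a, hax, fun z h _ => h⟩
    obtain ⟨s, hs⟩ := cs.exists_leftDescent_of_ne_one ha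
    obtain ⟨t, ht⟩ := cs.exists_leftDescent_of_ne_one hb
    by_cases hst : s = t
    · subst hst
      exact exists_isLubUnder_of_common_descent hK hw₀ hx ih' hs ht hax hbx
    have hs₀ := (hw₀ a).isLeftDescent hs
    have ht₀ := (hw₀ b).isLeftDescent ht
    have hr := isReduced_altList hst hs₀ ht₀
    have hds := isLeftDescent_wordProd_altList hst hs₀ ht₀
    have hdt := isLeftDescent_wordProd_altList (Ne.symm hst) ht₀ hs₀
    rw [M.symmetric t s, ← wordProd_altList_braid] at hdt
    have hdx : lft cs (cs.wordProd (altList s t (M s t))) ∣ x := by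
      obtain ⟨c, hc⟩ := hax
      obtain ⟨d, hd⟩ := hbx
      rw [lft_eq_sig_mul cs hs, mul_assoc] at hc
      rw [lft_eq_sig_mul cs ht, mul_assoc] at hd
      have hlen : plen M x = 1 + plen M (lft cs (cs.simple s * a) * c) := by
        rw [hc, plen_mul, plen_sig]
      rw [lft_wordProd cs hr, hc]
      exact (hK s t _ _ (hc.symm.trans hd) (by omega)).wd_dvd hst
    obtain ⟨v₁, h1⟩ := exists_isLubUnder_of_common_descent hK hw₀ hx ih' hs hds hax hdx
    obtain ⟨v₂, h2⟩ := exists_isLubUnder_of_common_descent hK hw₀ hx ih' ht hdt hbx hdx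
    obtain ⟨v, h⟩ := exists_isLubUnder_of_common_descent hK hw₀ hx ih'
      (h1.1.isLeftDescent hs) (h2.2.1.isLeftDescent hds) h1.2.2.1 h2.2.2.1
    refine ⟨v, h1.1.trans h.1, h2.1.trans h.2.1, h.2.2.1, fun z haz hbz => ?_⟩
    have hdz := weakLE_wordProd_altList hst (haz.isLeftDescent hs) (hbz.isLeftDescent ht)
    exact h.2.2.2 z (h1.2.2.2 z haz hdz) (h2.2.2.2 z hbz hdz)

theorem eq_lft_mul_of_diamond {N : ℕ} (hK : DiamondBelow M N) {r s : B} (hsr : s ≠ r)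
    {u x y : BraidMonoid M} (hx : plen M x ≤ N) (h : Diamond s r u x) {z : W}
    (hr : cs.IsLeftDescent z r) (hs : cs.IsLeftDescent z s)
    (hy : x = lft cs (cs.simple r * z) * y) : u = lft cs (cs.simple s * z) * y := by
  rcases h with ⟨rfl, -⟩ | ⟨-, -, w, rfl, hw⟩
  · exact absurd rfl hsr
  obtain ⟨-, c, h1, h2⟩ := exists_lft_simple_mul hsr hs hr
  rw [h1, mul_assoc]
  rw [h2, hw, mul_assoc] at hy
  rw [hw] at hx
  rw [hK.wd_mul_left_cancel hy hx]

theorem weakLE_simple_mul_altList {r s : B} (hsr : s ≠ r) {z : W} (hr : cs.IsLeftDescent z r)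
    (hs : cs.IsLeftDescent z s) :
    cs.IsReduced (altList s r (M s r - 1)) ∧
      cs.IsLeftDescent (cs.simple r * cs.wordProd (altList s r (M s r - 1))) s ∧
      cs.IsLeftDescent (cs.simple r * cs.wordProd (altList s r (M s r - 1))) r ∧
      WeakLE cs (cs.simple r * cs.wordProd (altList s r (M s r - 1))) z := by
  obtain ⟨h0, -⟩ := exists_eq_braid_mul cs hsr hs hr
  have hred := isReduced_altList hsr.symm hr hs
  have e : cs.simple r * cs.wordProd (altList s r (M s r - 1)) =
      cs.wordProd (altList r s (M r s)) := by
    rw [← cs.wordProd_cons, M.symmetric r s, altList_pred r s h0]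
  have e' : cs.simple r * cs.wordProd (altList s r (M s r - 1)) =
      cs.wordProd (altList s r (M s r)) := by
    rw [e, wordProd_altList_braid, M.symmetric r s]
  refine ⟨?_, ?_, ?_, ?_⟩
  · rw [M.symmetric r s, altList_pred r s h0] at hred
    exact isReduced_of_cons cs hred
  · rw [e']; exact isLeftDescent_wordProd_altList hsr hs hr
  · rw [e]; exact isLeftDescent_wordProd_altList hsr.symm hr hs
  · rw [e']; exact weakLE_wordProd_altList hsr hs hr

theorem Diamond.trans {N : ℕ} (hK : DiamondBelow M N) {w₀ : W}
    (hw₀ : ∀ a, WeakLE cs a w₀) {r s t : B} {u x v : BraidMonoid M} (hx : plen M x ≤ N)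
    (h : Diamond s r u x) (h' : Diamond r t x v) : Diamond s t u v := by
  by_cases hsr : s = r
  · rcases h with ⟨rfl, rfl⟩ | ⟨h, -⟩
    · exact h'
    · exact absurd hsr h
  by_cases htr : t = r
  · rcases h' with ⟨rfl, rfl⟩ | ⟨h', -⟩
    · exact h
    · exact absurd htr.symm h'
  have hd : ∀ s, cs.IsLeftDescent w₀ s := fun s => weakLE_simple_iff.mp (hw₀ _)
  obtain ⟨hra, hsa, hsa', hpa⟩ := weakLE_simple_mul_altList (cs := cs) hsr (hd r) (hd s)
  obtain ⟨hrb, htb, htb', hpb⟩ := weakLE_simple_mul_altList (cs := cs) htr (hd r) (hd t)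
  have hax : lft cs (cs.wordProd (altList s r (M s r - 1))) ∣ x := by
    rcases h with ⟨e, -⟩ | ⟨-, -, w, -, hw⟩
    · exact absurd e hsr
    · rw [lft_wordProd cs hra]; exact ⟨w, hw⟩
  have hbx : lft cs (cs.wordProd (altList t r (M t r - 1))) ∣ x := by
    rcases h' with ⟨e, -⟩ | ⟨-, -, w, hw, -⟩
    · exact absurd e.symm htr
    · rw [lft_wordProd cs hrb, M.symmetric t r]; exact ⟨w, hw⟩
  obtain ⟨v₀, hav, hbv, ⟨y, hy⟩, hv⟩ := exists_isLubUnder hK hw₀ x hx _ _ hax hbx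
  have hpa' := (weakLE_simple_mul_iff hsa' (hd r)).mpr hpa
  have hpb' := (weakLE_simple_mul_iff htb' (hd r)).mpr hpb
  rw [cs.simple_mul_simple_cancel_left] at hpa' hpb'
  have hrv : cs.IsLeftDescent (cs.simple r * v₀) r :=
    isLeftDescent_simple_mul (not_isLeftDescent_of_weakLE (hd r) (hv _ hpa' hpb'))
  rw [← cs.simple_mul_simple_cancel_left (w := v₀) r] at hy
  have hs : cs.IsLeftDescent (cs.simple r * v₀) s := by
    refine WeakLE.isLeftDescent ?_ hsa
    rwa [← weakLE_simple_mul_iff hsa' hrv, cs.simple_mul_simple_cancel_left,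
      cs.simple_mul_simple_cancel_left]
  have ht : cs.IsLeftDescent (cs.simple r * v₀) t := by
    refine WeakLE.isLeftDescent ?_ htb
    rwa [← weakLE_simple_mul_iff htb' hrv, cs.simple_mul_simple_cancel_left,
      cs.simple_mul_simple_cancel_left]
  have hu := eq_lft_mul_of_diamond hK hsr hx h hrv hs hy
  have hv := eq_lft_mul_of_diamond hK htr hx h'.symm hrv ht hy
  by_cases hst : s = t
  · subst hst
    exact Or.inl ⟨rfl, hu.trans hv.symm⟩
  · obtain ⟨h0, c, h1, h2⟩ := exists_lft_simple_mul hst hs ht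
    exact Or.inr ⟨hst, h0, lft cs c * y, by rw [hu, h1, mul_assoc], by rw [hv, h2, mul_assoc]⟩

theorem diamondBelow [Finite W] (cs : CoxeterSystem M W) (N : ℕ) : DiamondBelow M N := by
  obtain ⟨w₀, hw₀⟩ := exists_longest cs
  replace hw₀ : ∀ a, WeakLE cs a w₀ := hw₀
  induction N with
  | zero => intro s t u v _ h; omega
  | succ N hK =>
    have key : ∀ l l' : FreeMonoid B, ConGen.Rel (braidStep M) l l' →
        wd M (FreeMonoid.toList l) = wd M (FreeMonoid.toList l') ∧
        ∀ s t u v, FreeMonoid.toList l = s :: u → FreeMonoid.toList l' = t :: v →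
          u.length < N + 1 → Diamond s t (wd M u) (wd M v) := by
      intro l l' h
      induction h with
      | of x y h =>
        obtain ⟨s, t, hst, h0, rfl, rfl⟩ := h
        refine ⟨wd_braid M hst h0, fun s' t' u v hu hv _ => ?_⟩
        rw [FreeMonoid.toList_ofList] at hu hv
        rw [altList_pred _ _ h0] at hu hv
        obtain ⟨rfl, rfl⟩ := List.cons.inj hu
        obtain ⟨rfl, rfl⟩ := List.cons.inj hv
        exact Or.inr ⟨hst, h0, 1, by simp, by simp⟩
      | refl x =>
        refine ⟨rfl, fun s t u v hu hv _ => ?_⟩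
        obtain ⟨rfl, rfl⟩ := List.cons.inj (hu.symm.trans hv)
        exact Or.inl ⟨rfl, rfl⟩
      | @symm x y _ ih =>
        refine ⟨ih.1.symm, fun s t u v hu hv hl => (ih.2 t s v u hv hu ?_).symm⟩
        have := congrArg (plen M) ih.1
        rw [hu, hv, plen_wd, plen_wd] at this
        simp only [List.length_cons] at this
        omega
      | @trans x y z _ _ ih ih' =>
        refine ⟨ih.1.trans ih'.1, fun s t u v hu hv hl => ?_⟩
        have hlen := congrArg (plen M) ih.1
        rw [hu, plen_wd, plen_wd] at hlen
        obtain ⟨r, p, hp⟩ := List.exists_cons_of_length_eq_add_one hlen.symm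
        have hlp : u.length = p.length := by rw [hp] at hlen; simpa using hlen
        exact (ih.2 s r u p hu hp hl).trans hK hw₀ (by rw [plen_wd]; omega)
          (ih'.2 r t p v hp hv (by omega))
      | @mul a b c d _ _ ih ih' =>
        rw [FreeMonoid.toList_mul, FreeMonoid.toList_mul, wd_append, wd_append]
        refine ⟨by rw [ih.1, ih'.1], fun s t u v hu hv hl => ?_⟩
        have hlen := congrArg (plen M) ih.1
        rw [plen_wd, plen_wd] at hlen
        rcases ha : FreeMonoid.toList a with _ | ⟨s', a'⟩
        · have hb : FreeMonoid.toList b = [] := by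
            rw [ha] at hlen; exact List.length_eq_zero_iff.mp hlen.symm
          rw [ha] at hu
          rw [hb] at hv
          exact ih'.2 s t u v hu hv hl
        · rw [ha] at hlen
          obtain ⟨t', b', hb⟩ := List.exists_cons_of_length_eq_add_one hlen.symm
          rw [ha] at hu
          rw [hb] at hv
          obtain ⟨rfl, rfl⟩ := List.cons.inj hu
          obtain ⟨rfl, rfl⟩ := List.cons.inj hv
          rw [List.append_eq, List.append_eq] at *
          rw [List.length_append] at hl
          rw [wd_append, wd_append, ← ih'.1]
          exact (ih.2 _ _ _ _ ha hb (by omega)).mul_right _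
    intro s t u v h hu
    obtain ⟨u, rfl⟩ := wd_surjective M u
    obtain ⟨v, rfl⟩ := wd_surjective M v
    rw [← wd_cons, ← wd_cons] at h
    rw [plen_wd] at hu
    refine (key (FreeMonoid.ofList (s :: u)) (FreeMonoid.ofList (t :: v)) ?_).2 s t u v rfl rfl hu
    refine PresentedMonoid.mk_eq_mk_iff.mp ?_
    rw [mk_eq_wd, mk_eq_wd]
    exact h

end Diamond

section Reversal

variable {M : CoxeterMatrix B}

theorem reverse_altList (s t : B) (n : ℕ) :
    (altList s t n).reverse = if Even n then altList t s n else altList s t n := by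
  have key : CoxeterSystem.alternatingWord t s n =
      if Even n then altList t s n else altList s t n := by
    induction n with
    | zero => rfl
    | succ n ih =>
      rw [CoxeterSystem.alternatingWord_succ', ih]
      by_cases h : Even n <;> simp [h, Nat.even_add_one, altList]
  rw [← key, altList_eq_reverse_alternatingWord, List.reverse_reverse]

theorem wd_reverse_braid {s t : B} (hst : s ≠ t) (h0 : M s t ≠ 0) :
    wd M (altList s t (M s t)).reverse = wd M (altList t s (M s t)).reverse := by
  rw [reverse_altList, reverse_altList]
  split_ifs
  · exact (wd_braid M hst h0).symm
  · exact wd_braid M hst h0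

variable (M) in
/-- Reversal of words, as a morphism from the Artin-Tits monoid to its opposite. -/
def revHom : BraidMonoid M →* (BraidMonoid M)ᵐᵒᵖ :=
  PresentedMonoid.lift (fun s => MulOpposite.op (sig M s)) (by
    rintro x y ⟨s, t, hst, h0, rfl, rfl⟩
    have : ∀ l : List B, FreeMonoid.lift (fun s => MulOpposite.op (sig M s))
        (FreeMonoid.ofList l) = MulOpposite.op (wd M l.reverse) := by
      intro l
      induction l with
      | nil => simp
      | cons s l ih => rw [FreeMonoid.ofList_cons, map_mul, ih]; simp
    rw [this, this, wd_reverse_braid hst h0])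

/-- Reversal of words, on the Artin-Tits monoid. -/
def rev (x : BraidMonoid M) : BraidMonoid M := MulOpposite.unop (revHom M x)

theorem rev_mul (x y : BraidMonoid M) : rev (x * y) = rev y * rev x := by simp [rev]

theorem rev_sig (s : B) : rev (sig M s) = sig M s := rfl

theorem rev_rev (x : BraidMonoid M) : rev (rev x) = x := by
  obtain ⟨l, rfl⟩ := wd_surjective M x
  induction l with
  | nil => simp [rev]
  | cons s l ih => rw [wd_cons, rev_mul, rev_mul, ih, rev_sig, rev_sig]

/-- `v` is a least common right multiple of `a` and `b`, and it divides `x`. -/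
def IsLcmUnder (x a b v : BraidMonoid M) : Prop :=
  a ∣ v ∧ b ∣ v ∧ v ∣ x ∧ ∀ z, a ∣ z → b ∣ z → v ∣ z

end Reversal

section Garside

variable {W : Type*} [Group W] {M : CoxeterMatrix B}

theorem diamond_of_eq [Finite W] (cs : CoxeterSystem M W)
    {s t : B} {u v : BraidMonoid M} (h : sig M s * u = sig M t * v) :
    Diamond s t u v :=
  diamondBelow cs (plen M u + 1) s t u v h (Nat.lt_succ_self _)

theorem braid_mul_left_cancel [Finite W] (cs : CoxeterSystem M W)
    {x u v : BraidMonoid M} (h : x * u = x * v) : u = v := by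
  obtain ⟨l, rfl⟩ := wd_surjective M x
  exact (diamondBelow cs _).wd_mul_left_cancel h le_rfl

theorem braid_mul_right_cancel [Finite W] (cs : CoxeterSystem M W)
    {x u v : BraidMonoid M} (h : u * x = v * x) : u = v := by
  have h' := congrArg rev h
  rw [rev_mul, rev_mul] at h'
  rw [← rev_rev u, braid_mul_left_cancel cs h', rev_rev]

theorem dvd_of_mul_dvd_mul_left [Finite W] (cs : CoxeterSystem M W)
    {x u v : BraidMonoid M} (h : x * u ∣ x * v) : u ∣ v := by
  obtain ⟨c, hc⟩ := h
  rw [mul_assoc] at hc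
  exact ⟨c, braid_mul_left_cancel cs hc⟩

theorem exists_common_right_mul_lft [Finite W] (cs : CoxeterSystem M W)
    (x : BraidMonoid M) (w : W) :
    ∃ (w' : W) (x' : BraidMonoid M), x * lft cs w' = lft cs w * x' := by
  obtain ⟨w₀, hw₀⟩ := exists_longest cs
  replace hw₀ : ∀ a, WeakLE cs a w₀ := hw₀
  obtain ⟨l, rfl⟩ := wd_surjective M x
  induction l generalizing w with
  | nil => exact ⟨w, 1, by simp⟩
  | cons s l ih =>
    obtain ⟨w', x', h⟩ := ih (cs.simple s * w₀)
    refine ⟨w', lft cs (w⁻¹ * w₀) * x', ?_⟩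
    rw [wd_cons, mul_assoc, h, ← mul_assoc, ← mul_assoc, ← lft_eq_mul_of_weakLE (hw₀ w),
      ← lft_eq_sig_mul cs (weakLE_simple_iff.mp (hw₀ _))]

theorem exists_common_right_multiple [Finite W] (cs : CoxeterSystem M W)
    (x y : BraidMonoid M) : ∃ p q, x * p = y * q := by
  obtain ⟨l, rfl⟩ := wd_surjective M y
  induction l generalizing x with
  | nil => exact ⟨1, x, by simp⟩
  | cons s l ih =>
    obtain ⟨w, x', h⟩ := exists_common_right_mul_lft cs x (cs.simple s)
    obtain ⟨p, q, hpq⟩ := ih x'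
    exact ⟨lft cs w * p, q, by rw [← mul_assoc, h, mul_assoc, hpq, lft_simple, wd_cons, mul_assoc]⟩

theorem exists_common_left_multiple [Finite W] (cs : CoxeterSystem M W)
    (x y : BraidMonoid M) : ∃ p q, p * x = q * y := by
  obtain ⟨p, q, h⟩ := exists_common_right_multiple cs (rev x) (rev y)
  refine ⟨rev p, rev q, ?_⟩
  have h' := congrArg rev h
  rwa [rev_mul, rev_mul, rev_rev, rev_rev] at h'

theorem exists_isLcmUnder_of_common_sig [Finite W] (cs : CoxeterSystem M W)
    {x a b : BraidMonoid M} {s : B}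
    (ih : ∀ x', plen M x' < plen M x → ∀ a b : BraidMonoid M, a ∣ x' → b ∣ x' →
      ∃ v, IsLcmUnder x' a b v)
    (ha : sig M s ∣ a) (hb : sig M s ∣ b) (hax : a ∣ x) (hbx : b ∣ x) :
    ∃ v, IsLcmUnder x a b v := by
  obtain ⟨a, rfl⟩ := ha
  obtain ⟨b, rfl⟩ := hb
  obtain ⟨x, rfl⟩ := (Dvd.intro _ rfl).trans hax
  obtain ⟨v, h1, h2, h3, h4⟩ := ih x (by simp) a b
    (dvd_of_mul_dvd_mul_left cs hax) (dvd_of_mul_dvd_mul_left cs hbx)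
  refine ⟨sig M s * v, mul_dvd_mul_left _ h1, mul_dvd_mul_left _ h2, mul_dvd_mul_left _ h3,
    fun z hz hz' => ?_⟩
  obtain ⟨z, rfl⟩ := (Dvd.intro _ rfl).trans hz
  exact mul_dvd_mul_left _
    (h4 z (dvd_of_mul_dvd_mul_left cs hz) (dvd_of_mul_dvd_mul_left cs hz'))

theorem wd_altList_dvd [Finite W] (cs : CoxeterSystem M W)
    {s t : B} (hst : s ≠ t) {x : BraidMonoid M} (hs : sig M s ∣ x)
    (ht : sig M t ∣ x) : M s t ≠ 0 ∧ wd M (altList s t (M s t)) ∣ x := by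
  obtain ⟨u, rfl⟩ := hs
  obtain ⟨v, h⟩ := ht
  have hd := diamond_of_eq cs h
  refine ⟨?_, hd.wd_dvd hst⟩
  rcases hd with ⟨h, -⟩ | ⟨-, h, -⟩
  · exact absurd h hst
  · exact h

theorem exists_isLcmUnder [Finite W] (cs : CoxeterSystem M W)
    (x a b : BraidMonoid M) (hax : a ∣ x) (hbx : b ∣ x) :
    ∃ v, IsLcmUnder x a b v := by
  induction hn : plen M x using Nat.strong_induction_on generalizing x a b with
  | _ n ih =>
    subst hn
    have ih' : ∀ x', plen M x' < plen M x → ∀ a b : BraidMonoid M, a ∣ x' → b ∣ x' →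
        ∃ v, IsLcmUnder x' a b v := fun x' hx' a b h h' => ih _ hx' x' a b h h' rfl
    rcases eq_one_or_eq_sig_mul a with rfl | ⟨s, a', ha⟩
    · exact ⟨b, one_dvd b, dvd_rfl, hbx, fun z _ h => h⟩
    rcases eq_one_or_eq_sig_mul b with rfl | ⟨t, b', hb⟩
    · exact ⟨a, dvd_rfl, one_dvd a, hax, fun z h _ => h⟩
    replace ha : sig M s ∣ a := ⟨a', ha⟩
    replace hb : sig M t ∣ b := ⟨b', hb⟩
    by_cases hst : s = t
    · subst hst
      exact exists_isLcmUnder_of_common_sig cs ih' ha hb hax hbx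
    obtain ⟨h0, hdx⟩ := wd_altList_dvd cs hst (ha.trans hax) (hb.trans hbx)
    have hds : sig M s ∣ wd M (altList s t (M s t)) := by
      rw [altList_pred s t h0]; exact ⟨_, wd_cons ..⟩
    have hdt : sig M t ∣ wd M (altList s t (M s t)) := by
      rw [wd_braid M hst h0, altList_pred t s h0]; exact ⟨_, wd_cons ..⟩
    obtain ⟨v₁, h1⟩ := exists_isLcmUnder_of_common_sig cs ih' ha hds hax hdx
    obtain ⟨v₂, h2⟩ := exists_isLcmUnder_of_common_sig cs ih' hb hdt hbx hdx
    obtain ⟨v, h⟩ := exists_isLcmUnder_of_common_sig cs ih'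
      (ha.trans h1.1) (hds.trans h2.2.1) h1.2.2.1 h2.2.2.1
    refine ⟨v, h1.1.trans h.1, h2.1.trans h.2.1, h.2.2.1, fun z haz hbz => ?_⟩
    have hdz := (wd_altList_dvd cs hst (ha.trans haz) (hb.trans hbz)).2
    exact h.2.2.2 z (h1.2.2.2 z haz hdz) (h2.2.2.2 z hbz hdz)

end Garside

section Embedding

variable {M : CoxeterMatrix B}

theorem prod_gen_braid {s t : B} (hst : s ≠ t) (h0 : M s t ≠ 0) :
    ((altList s t (M s t)).map (gen M)).prod = ((altList t s (M s t)).map (gen M)).prod := by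
  have h : PresentedGroup.mk (braidRels M) _ = 1 :=
    PresentedGroup.one_of_mem ⟨s, t, hst, h0, rfl⟩
  rw [map_mul, map_inv, mul_inv_eq_one, map_list_prod, map_list_prod, List.map_map,
    List.map_map] at h
  exact h

variable (M) in
/-- The canonical morphism from the Artin-Tits monoid to the Artin-Tits group. -/
def toArtin : BraidMonoid M →* Artin M :=
  PresentedMonoid.lift (gen M) (by
    rintro x y ⟨s, t, hst, h0, rfl, rfl⟩
    simpa [FreeMonoid.lift_apply] using prod_gen_braid hst h0)

@[simp] theorem toArtin_sig (s : B) : toArtin M (sig M s) = gen M s := rfl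

theorem mem_posMon_iff {g : Artin M} : g ∈ posMon M ↔ ∃ x, toArtin M x = g := by
  constructor
  · intro h
    have hle : posMon M ≤ MonoidHom.mrange (toArtin M) := by
      rw [posMon, Submonoid.closure_le]
      rintro _ ⟨s, rfl⟩
      exact ⟨sig M s, rfl⟩
    exact hle h
  · rintro ⟨x, rfl⟩
    obtain ⟨l, rfl⟩ := wd_surjective M x
    induction l with
    | nil => simp [one_mem]
    | cons s l ih =>
      rw [wd_cons, map_mul]
      exact mul_mem (Submonoid.subset_closure ⟨s, rfl⟩) ih

/-- The Artin-Tits monoid of spherical type embeds in its group of fractions. -/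
theorem toArtin_injective {W : Type*} [Group W] [Finite W] (cs : CoxeterSystem M W) :
    Function.Injective (toArtin M) := by
  choose num den hnd using fun x y : BraidMonoid M => exists_common_left_multiple cs y x
  let : OreLocalization.OreSet (⊤ : Submonoid (BraidMonoid M)) :=
    { ore_right_cancel := fun x y s h => ⟨1, by rw [braid_mul_right_cancel cs h]⟩
      oreNum := fun r s => num r s
      oreDenom := fun r s => ⟨den r s, trivial⟩
      ore_eq := fun r s => (hnd r s).symm }
  let ι : BraidMonoid M →* OreLocalization (⊤ : Submonoid (BraidMonoid M)) (BraidMonoid M) :=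
    OreLocalization.numeratorHom
  have hι : Function.Injective ι := by
    intro x y h
    obtain ⟨u, v, h1, h2⟩ := OreLocalization.oreDiv_eq_iff.mp h
    have h2' : (u : BraidMonoid M) = v := by simpa using h2
    have h1' : (u : BraidMonoid M) * y = v * x := h1
    rw [h2'] at h1'
    exact (braid_mul_left_cancel cs h1').symm
  let un : BraidMonoid M →* (OreLocalization (⊤ : Submonoid (BraidMonoid M)) (BraidMonoid M))ˣ :=
    { toFun := fun x => OreLocalization.numeratorUnit ⟨x, trivial⟩
      map_one' := Units.ext (map_one ι)
      map_mul' := fun x y => Units.ext (map_mul ι x y) }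
  have hun : ∀ l : List B, un (wd M l) = (l.map fun s => un (sig M s)).prod := fun l => by
    rw [wd, map_list_prod, List.map_map]; rfl
  let ψ : Artin M →* (OreLocalization (⊤ : Submonoid (BraidMonoid M)) (BraidMonoid M))ˣ :=
    PresentedGroup.toGroup (f := fun s => un (sig M s)) (by
      rintro r ⟨s, t, hst, h0, rfl⟩
      rw [map_mul, map_inv, mul_inv_eq_one, map_list_prod, map_list_prod, List.map_map,
        List.map_map]
      have h := congrArg un (wd_braid M hst h0)
      rw [hun, hun] at h
      simpa [Function.comp_def] using h)
  have hψ : ∀ x, ψ (toArtin M x) = un x := by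
    intro x
    obtain ⟨l, rfl⟩ := wd_surjective M x
    induction l with
    | nil => simp
    | cons s l ih =>
      rw [wd_cons, map_mul, map_mul, ih, map_mul, toArtin_sig]
      congr 1
      exact PresentedGroup.toGroup.of _
  intro x y h
  have h' := congrArg ψ h
  rw [hψ, hψ] at h'
  exact hι (congrArg Units.val h')

/-- If `a b⁻¹ = g₁ g₂⁻¹`, where `g₁` and `g₂` have no common right divisor, then `a` and `b` are
obtained by multiplying `g₁` and `g₂` on the right by the same element. -/
theorem exists_eq_mul_of_mul_inv_eq {W : Type*} [Group W] [Finite W] (cs : CoxeterSystem M W)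
    {g₁ g₂ a b : BraidMonoid M}
    (hgcd : ∀ c p q : BraidMonoid M, g₁ = p * c → g₂ = q * c → c = 1)
    (h : toArtin M a * (toArtin M b)⁻¹ = toArtin M g₁ * (toArtin M g₂)⁻¹) :
    ∃ c, a = g₁ * c ∧ b = g₂ * c := by
  obtain ⟨x, y, hxy⟩ := exists_common_left_multiple cs g₁ g₂
  have hab : x * a = y * b := by
    apply toArtin_injective cs
    have h' := congrArg (toArtin M) hxy
    rw [map_mul, map_mul] at h' ⊢
    have e : toArtin M a = toArtin M g₁ * (toArtin M g₂)⁻¹ * toArtin M b := by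
      rw [← h, inv_mul_cancel_right]
    rw [e, ← mul_assoc, ← mul_assoc, h', mul_inv_cancel_right]
  obtain ⟨v, ⟨p, rfl⟩, ⟨q, hq⟩, ⟨e, he⟩, hv⟩ :=
    exists_isLcmUnder cs (x * g₁) x y (Dvd.intro _ rfl) ⟨g₂, hxy⟩
  have h1 : g₁ = p * e := braid_mul_left_cancel cs (x := x) (by rw [he, mul_assoc])
  have h2 : g₂ = q * e := braid_mul_left_cancel cs (x := y) (by rw [← hxy, he, hq, mul_assoc])
  obtain rfl := hgcd e p q h1 h2
  rw [mul_one] at h1 h2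
  subst h1 h2
  obtain ⟨c, hc⟩ := hv (x * a) (Dvd.intro _ rfl) ⟨b, hab⟩
  refine ⟨c, braid_mul_left_cancel cs (x := x) (by rw [hc, mul_assoc]), ?_⟩
  exact braid_mul_left_cancel cs (x := y) (by rw [← hab, hc, hq, mul_assoc])

end Embedding

/-- **Lemma (Godelle).** In a spherical-type Artin-Tits system, if `gX = Yg` and
`g = g₁g₂⁻¹` is the right normal form of `g`, then `g₁ ∈ Conj⁺(S;X',Y)` and
`g₂ ∈ Conj⁺(S;X',X)` for some `X' ⊆ S`. -/
theorem normal_form_of_conjugator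
    [Finite B] (M : CoxeterMatrix B) (hsph : Finite M.Group) (X Y : Set B)
    (g g₁ g₂ : Artin M) (hconj : rightMul M X g = leftMul M Y g)
    (h1 : g₁ ∈ posMon M) (h2 : g₂ ∈ posMon M) (hg : g = g₁ * g₂⁻¹)
    (hgcd : ∀ c ∈ posMon M, rdvd M c g₁ → rdvd M c g₂ → c = 1) :
    ∃ X' : Set B, g₁ ∈ conjPos M X' Y ∧ g₂ ∈ conjPos M X' X := by
  have key : ∀ s t, g * gen M s = gen M t * g →
      ∃ u, g₁ * gen M u = gen M t * g₁ ∧ g₂ * gen M u = gen M s * g₂ := by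
    intro s t hst
    obtain ⟨x₁, rfl⟩ := mem_posMon_iff.mp h1
    obtain ⟨x₂, rfl⟩ := mem_posMon_iff.mp h2
    have hinj := toArtin_injective M.toCoxeterSystem
    obtain ⟨c, hc1, hc2⟩ := exists_eq_mul_of_mul_inv_eq M.toCoxeterSystem
      (g₁ := x₁) (g₂ := x₂) (a := sig M t * x₁) (b := sig M s * x₂) (by
        intro c p q hp hq
        apply hinj
        rw [map_one]
        exact hgcd _ (mem_posMon_iff.mpr ⟨c, rfl⟩)
          ⟨_, mem_posMon_iff.mpr ⟨p, rfl⟩, by rw [← map_mul, ← hp]⟩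
          ⟨_, mem_posMon_iff.mpr ⟨q, rfl⟩, by rw [← map_mul, ← hq]⟩) (by
        rw [hg] at hst
        rw [map_mul, map_mul, toArtin_sig, toArtin_sig, mul_inv_rev, ← mul_assoc,
          mul_assoc (gen M t), ← hst, mul_inv_cancel_right])
    have hlen := congrArg (plen M) hc1
    rw [plen_mul, plen_mul, plen_sig] at hlen
    obtain ⟨u, rfl⟩ := exists_eq_sig_of_plen_eq_one (x := c) (by omega)
    refine ⟨u, ?_, ?_⟩
    · simpa using (congrArg (toArtin M) hc1).symm
    · simpa using (congrArg (toArtin M) hc2).symm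
  have hX : ∀ s ∈ X, ∃ t ∈ Y, g * gen M s = gen M t * g := fun s hs => by
    obtain ⟨t, ht, h⟩ : g * gen M s ∈ leftMul M Y g := hconj ▸ ⟨s, hs, rfl⟩
    exact ⟨t, ht, h.symm⟩
  have hY : ∀ t ∈ Y, ∃ s ∈ X, g * gen M s = gen M t * g := fun t ht => by
    obtain ⟨s, hs, h⟩ : gen M t * g ∈ rightMul M X g := hconj ▸ ⟨t, ht, rfl⟩
    exact ⟨s, hs, h⟩
  refine ⟨{u | (∃ t ∈ Y, g₁ * gen M u = gen M t * g₁) ∧ ∃ s ∈ X, g₂ * gen M u = gen M s * g₂},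
    ⟨h1, ?_⟩, ⟨h2, ?_⟩⟩
  · apply Set.Subset.antisymm
    · rintro _ ⟨u, ⟨⟨t, ht, h⟩, -⟩, rfl⟩
      exact ⟨t, ht, h.symm⟩
    · rintro _ ⟨t, ht, rfl⟩
      obtain ⟨s, hs, hst⟩ := hY t ht
      obtain ⟨u, hu1, hu2⟩ := key s t hst
      exact ⟨u, ⟨⟨t, ht, hu1⟩, s, hs, hu2⟩, hu1⟩
  · apply Set.Subset.antisymm
    · rintro _ ⟨u, ⟨-, s, hs, h⟩, rfl⟩
      exact ⟨s, hs, h.symm⟩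
    · rintro _ ⟨s, hs, rfl⟩
      obtain ⟨t, ht, hst⟩ := hX s hs
      obtain ⟨u, hu1, hu2⟩ := key s t hst
      exact ⟨u, ⟨⟨t, ht, hu1⟩, s, hs, hu2⟩, hu2⟩

end ArtinTitsPaper
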